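/- arXiv:1309.5336 — 2 statements merged into one kernel-verified Lean document; each statement's English description precedes it below -/
import Mathlib

section
/- Let G be an internally 4-connected bipartite graph. Then every optimal hex of G has at least five odd segments. -/
open SimpleGraph

universe u

variable {V : Type u}

/-- A planar embedding of a simple graph: vertices go to distinct points of the plane and
edges to arcs (injective topological paths) that meet only at common endpoints. -/
structure PlanarEmbedding (G : SimpleGraph V) where
  vmap : V → ℝ × ℝ
  vmap_inj : Function.Injective vmap
  arc : ∀ ⦃x y : V⦄, G.Adj x y → _root_.Path (vmap x) (vmap y)
  arc_inj : ∀ ⦃x y : V⦄ (h : G.Adj x y), Function.Injective ⇑(arc h)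
  arc_symm : ∀ ⦃x y : V⦄ (h : G.Adj x y), Set.range ⇑(arc h) = Set.range ⇑(arc h.symm)
  arc_vertex : ∀ ⦃x y : V⦄ (h : G.Adj x y) (w : V), vmap w ∈ Set.range ⇑(arc h) → w = x ∨ w = y
  arc_disjoint : ∀ ⦃x y x' y' : V⦄ (h : G.Adj x y) (h' : G.Adj x' y'),
      s(x, y) ≠ s(x', y') →
      Set.range ⇑(arc h) ∩ Set.range ⇑(arc h') ⊆
        ({vmap x, vmap y} ∩ {vmap x', vmap y'} : Set (ℝ × ℝ))

/-- A graph is planar if it admits a planar embedding. -/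
def SimpleGraph.IsPlanar (G : SimpleGraph V) : Prop := Nonempty (PlanarEmbedding G)

/-- `(A, B)` is a bipartition of `G`. -/
def SimpleGraph.IsBipartition (G : SimpleGraph V) (A B : Set V) : Prop :=
  Disjoint A B ∧ A ∪ B = Set.univ ∧
    ∀ ⦃x y : V⦄, G.Adj x y → (x ∈ A ∧ y ∈ B) ∨ (x ∈ B ∧ y ∈ A)

/-- A finite graph is 3-connected: more than 3 vertices and removing at most 2 vertices
leaves a connected graph. -/
def SimpleGraph.ThreeConnected [Fintype V] (G : SimpleGraph V) : Prop :=
  4 ≤ Fintype.card V ∧ ∀ S : Set V, S.ncard ≤ 2 → (G.induce Sᶜ).Connected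

/-- Internally 4-connected: 3-connected, at least five vertices, and no partition
`(A, B, C)` of the vertices with `|A|, |B| ≥ 2`, `|C| = 3` and no edge between `A` and `B`. -/
def SimpleGraph.InternallyFourConnected [Fintype V] (G : SimpleGraph V) : Prop :=
  G.ThreeConnected ∧ 5 ≤ Fintype.card V ∧
    ¬ ∃ A B C : Set V, A ∪ B ∪ C = Set.univ ∧ Disjoint A B ∧ Disjoint A C ∧ Disjoint B C ∧
      2 ≤ A.ncard ∧ 2 ≤ B.ncard ∧ C.ncard = 3 ∧ ∀ x ∈ A, ∀ y ∈ B, ¬ G.Adj x y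

/-- A hex in `G`: a subdivision of `K_{3,3}` with feet `fA 0, fA 1, fA 2` on one side and
`fB 0, fB 1, fB 2` on the other, and nine internally disjoint segments `seg i j`. -/
structure SimpleGraph.Hex (G : SimpleGraph V) where
  fA : Fin 3 → V
  fB : Fin 3 → V
  injA : Function.Injective fA
  injB : Function.Injective fB
  disjAB : ∀ i j, fA i ≠ fB j
  seg : (i j : Fin 3) → G.Walk (fA i) (fB j)
  seg_path : ∀ i j, (seg i j).IsPath
  seg_meet : ∀ i j i' j', (i, j) ≠ (i', j') → ∀ x : V, x ∈ (seg i j).support →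
      x ∈ (seg i' j').support → (x = fA i ∧ i = i') ∨ (x = fB j ∧ j = j')

/-- The number of odd segments of a hex. -/
noncomputable def SimpleGraph.Hex.oddCount {G : SimpleGraph V} (H : G.Hex) : ℕ :=
  (Finset.univ.filter fun p : Fin 3 × Fin 3 => Odd (H.seg p.1 p.2).length).card

/-- A hex is odd if all nine segments have odd length. -/
def SimpleGraph.Hex.IsOdd {G : SimpleGraph V} (H : G.Hex) : Prop :=
  ∀ i j, Odd (H.seg i j).length

/-- A hex is optimal if no hex of `G` has strictly more odd segments. -/
def SimpleGraph.Hex.Optimal {G : SimpleGraph V} (H : G.Hex) : Prop :=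
  ∀ H' : G.Hex, H'.oddCount ≤ H.oddCount

/-- The vertex set of a walk, as a set. -/
def SimpleGraph.Walk.supp {G : SimpleGraph V} {x y : V} (w : G.Walk x y) : Set V :=
  {z | z ∈ w.support}

/-- The vertex set of a hex. -/
def SimpleGraph.Hex.suppSet {G : SimpleGraph V} (H : G.Hex) : Set V :=
  ⋃ (i : Fin 3) (j : Fin 3), (H.seg i j).supp

/-- The edge set of a hex. -/
def SimpleGraph.Hex.edgeSetH {G : SimpleGraph V} (H : G.Hex) : Set (Sym2 V) :=
  ⋃ (i : Fin 3) (j : Fin 3), {e | e ∈ (H.seg i j).edges}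

/-- Every walk from `A` to `B` meets `S`. -/
def SimpleGraph.Separates (G : SimpleGraph V) (A B : Set V) (S : Finset V) : Prop :=
  ∀ a ∈ A, ∀ b ∈ B, ∀ p : G.Walk a b, ∃ v ∈ p.support, v ∈ S

/-- There are `k` pairwise disjoint paths from `A` to `B`. -/
def SimpleGraph.HasLinkage (G : SimpleGraph V) (A B : Set V) (k : ℕ) : Prop :=
  ∃ (s t : Fin k → V) (p : ∀ i, G.Walk (s i) (t i)),
    (∀ i, s i ∈ A ∧ t i ∈ B ∧ (p i).IsPath) ∧
      ∀ i j v, v ∈ (p i).support → v ∈ (p j).support → i = j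

theorem SimpleGraph.HasLinkage.mono {G G' : SimpleGraph V} (h : G' ≤ G) {A B : Set V} {k : ℕ}
    (hl : G'.HasLinkage A B k) : G.HasLinkage A B k := by
  obtain ⟨s, t, p, hp, hd⟩ := hl
  exact ⟨s, t, fun i => (p i).mapLe h,
    fun i => ⟨(hp i).1, (hp i).2.1, (hp i).2.2.mapLe h⟩, by simpa using hd⟩

/-- If `G'` contains every edge of `G` except possibly `xy`, then a walk in `G` is a walk in `G'`
or goes through `x` and `y`. -/
theorem SimpleGraph.Walk.exists_walk_or_mem {G G' : SimpleGraph V} {x y : V}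
    (hG' : ∀ u v, G.Adj u v → s(u, v) ≠ s(x, y) → G'.Adj u v) {a b : V} (p : G.Walk a b) :
    (∃ q : G'.Walk a b, q.support = p.support) ∨ (x ∈ p.support ∧ y ∈ p.support) := by
  by_cases h : s(x, y) ∈ p.edges
  · exact .inr ⟨p.fst_mem_support_of_mem_edges h, p.snd_mem_support_of_mem_edges h⟩
  · refine .inl ⟨p.transfer G' ?_, p.support_transfer _⟩
    intro e he
    induction e with
    | _ u v => exact hG' u v (p.adj_of_mem_edges he) (fun h' => h (h' ▸ he))

/-- Let `G'` contain every edge of `G` except possibly `xy`. If `S` separates `A` from `B` in `G'`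
and `y` reaches `B` avoiding `S` there, then every separator of `A` from `S ∪ {x}` in `G'`
separates `A` from `B` in `G`. -/
theorem SimpleGraph.Separates.of_insert [DecidableEq V] {G G' : SimpleGraph V} {A B : Set V}
    {S T : Finset V} {x y b₀ : V} (hG' : ∀ u v, G.Adj u v → s(u, v) ≠ s(x, y) → G'.Adj u v)
    (hS : G'.Separates A B S) (hb₀ : b₀ ∈ B) (q : G'.Walk y b₀) (hq : ∀ v ∈ q.support, v ∉ S)
    (hT : G'.Separates A (insert x S : Finset V) T) : G.Separates A B T := by
  intro a ha b hb p
  by_contra! hp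
  have hxS : ∀ u (r : G'.Walk a u), (∀ v ∈ r.support, v ∉ T) → u ≠ x ∧ u ∉ S := by
    intro u r hr
    by_contra hcon
    obtain ⟨z, hz, hzT⟩ := hT a ha u (by
      simp only [Finset.coe_insert, Set.mem_insert_iff, Finset.mem_coe]; tauto) r
    exact hr z hz hzT
  have key : ∀ u b, b ∈ B → ∀ r : G.Walk u b, (∀ v ∈ r.support, v ∉ T) →
      ∀ r' : G'.Walk a u, (∀ v ∈ r'.support, v ∉ T) → (∀ v ∈ r'.support, v ∉ S) → False := by
    intro u b hb r
    induction r with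
    | nil =>
      intro _ r' _ hr'
      obtain ⟨v, hv, hvS⟩ := hS a ha _ hb r'
      exact hr' v hv hvS
    | @cons u u' _ huu' r ih =>
      intro hr r' hr'T hr'
      by_cases he : s(u, u') = s(x, y)
      · have hu : u = y := by
          rcases Sym2.eq_iff.1 he with ⟨h, -⟩ | ⟨h, -⟩
          · exact absurd h (hxS u r' hr'T).1
          · exact h
        subst hu
        obtain ⟨v, hv, hvS⟩ := hS a ha _ hb₀ (r'.append q)
        rcases (Walk.mem_support_append_iff _ _).1 hv with h | h
        · exact hr' v h hvS
        · exact hq v h hvS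
      · have hadj := hG' u u' huu' he
        have hT' : ∀ v ∈ (r'.concat hadj).support, v ∉ T := by
          intro v hv
          rw [Walk.support_concat, List.mem_append, List.mem_singleton] at hv
          rcases hv with hv | rfl
          · exact hr'T v hv
          · exact hr v (by simp)
        refine ih hb (fun v hv => hr v (by simp [hv])) (r'.concat hadj) hT' ?_
        intro v hv
        rw [Walk.support_concat, List.mem_append, List.mem_singleton] at hv
        rcases hv with hv | rfl
        · exact hr' v hv
        · exact (hxS v (r'.concat hadj) hT').2
  have haT : ∀ v ∈ (Walk.nil : G'.Walk a a).support, v ∉ T := by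
    simpa using hp a p.start_mem_support
  exact key a b hb p hp .nil haT (by simpa using (hxS a .nil haT).2)

/-- If `G'` contains every edge of `G` except possibly `xy`, and `S` separates `A` from `B` in `G'`
but not in `G`, then up to exchanging `x` and `y` some walks in `G'` avoiding `S` lead from `A` to
`x` and from `y` to `B`. -/
theorem SimpleGraph.Separates.exists_walks [DecidableEq V] {G G' : SimpleGraph V} {A B : Set V}
    {S : Finset V} {x₀ y₀ : V}
    (hG' : ∀ u v, G.Adj u v → s(u, v) ≠ s(x₀, y₀) → G'.Adj u v)
    (hS : G'.Separates A B S) (hnS : ¬ G.Separates A B S) :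
    ∃ x y, G.Adj x y ∧ s(x, y) = s(x₀, y₀) ∧
      (∃ a ∈ A, ∃ p : G'.Walk a x, ∀ v ∈ p.support, v ∉ S) ∧
      ∃ b ∈ B, ∃ p : G'.Walk y b, ∀ v ∈ p.support, v ∉ S := by
  simp only [Separates, not_forall, not_exists, not_and] at hnS
  obtain ⟨a, ha, b, hb, p, hp⟩ := hnS
  have key : ∀ u b, b ∈ B → ∀ r : G.Walk u b, r.IsPath → (∀ v ∈ r.support, v ∉ S) →
      ∀ r' : G'.Walk a u, (∀ v ∈ r'.support, v ∉ S) →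
      ∃ x y, G.Adj x y ∧ s(x, y) = s(x₀, y₀) ∧
      (∃ a ∈ A, ∃ p : G'.Walk a x, ∀ v ∈ p.support, v ∉ S) ∧
      ∃ b ∈ B, ∃ p : G'.Walk y b, ∀ v ∈ p.support, v ∉ S := by
    intro u b hb r
    induction r with
    | nil =>
      intro _ _ r' hr'
      obtain ⟨v, hv, hvS⟩ := hS a ha _ hb r'
      exact absurd hvS (hr' v hv)
    | @cons u u' _ huu' r ih =>
      intro hpath hr r' hr'
      rw [Walk.cons_isPath_iff] at hpath
      by_cases he : s(u, u') = s(x₀, y₀)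
      · refine ⟨u, u', huu', he, ⟨a, ha, r', hr'⟩, _, hb, ?_⟩
        rcases r.exists_walk_or_mem (x := u) (y := u') (he ▸ hG') with ⟨q, hq⟩ | h
        · exact ⟨q, fun v hv => hr v (by simp [← hq, hv])⟩
        · exact absurd h.1 hpath.2
      · refine ih hb hpath.1 (fun v hv => hr v (by simp [hv])) (r'.concat (hG' _ _ huu' he)) ?_
        intro v hv
        rw [Walk.support_concat, List.mem_append, List.mem_singleton] at hv
        rcases hv with hv | rfl
        · exact hr' v hv
        · exact hr v (by simp)
  exact key a b hb p.bypass p.bypass_isPath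
    (fun v hv => hp v (p.support_bypass_subset_support hv)) .nil
    (by simpa using hp a p.start_mem_support)

theorem SimpleGraph.Separates.symm {G : SimpleGraph V} {A B : Set V} {S : Finset V}
    (h : G.Separates A B S) : G.Separates B A S := by
  intro b hb a ha p
  obtain ⟨v, hv, hvS⟩ := h a ha b hb p.reverse
  exact ⟨v, by simpa using hv, hvS⟩

/-- A linkage ending in a set of its own size uses every vertex of this set, each of its paths
containing exactly one of them, as its end. -/
theorem SimpleGraph.HasLinkage.exists_paths {G : SimpleGraph V} {A : Set V} {T : Finset V} {k : ℕ}
    (hT : T.card = k) (h : G.HasLinkage A T k) :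
    ∃ (s : T → V) (p : ∀ t : T, G.Walk (s t) t), (∀ t, s t ∈ A ∧ (p t).IsPath) ∧
      ∀ i j v, v ∈ (p i).support → v ∈ (p j).support → i = j := by
  obtain ⟨s, t, p, hp, hd⟩ := h
  have hinj : Function.Injective (fun i => (⟨t i, (hp i).2.1⟩ : T)) := by
    intro i j hij
    have hij' : t i = t j := congrArg Subtype.val hij
    exact hd i j (t i) (p i).end_mem_support (by rw [hij']; exact (p j).end_mem_support)
  have hbij := (Fintype.bijective_iff_injective_and_card _).2 ⟨hinj, by simp [hT]⟩
  choose g hg using hbij.2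
  refine ⟨fun x => s (g x), fun x => (p (g x)).copy rfl (congrArg Subtype.val (hg x)),
    fun x => ⟨(hp _).1, by simpa using (hp (g x)).2.2⟩, ?_⟩
  intro i j v hi hj
  rw [Walk.support_copy] at hi hj
  rw [← hg i, ← hg j, hd _ _ v hi hj]

/-- **Menger's theorem**: if every set separating `A` from `B` has at least `k` vertices, then
there are `k` pairwise disjoint paths from `A` to `B`. -/
theorem SimpleGraph.hasLinkage_of_separates [Fintype V] (k : ℕ) (G : SimpleGraph V) (A B : Set V)
    (h : ∀ S : Finset V, G.Separates A B S → k ≤ S.card) : G.HasLinkage A B k := by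
  classical
  induction hn : G.edgeSet.ncard using Nat.strong_induction_on generalizing G A B with
  | _ n ih =>
  by_cases hbot : G = ⊥
  · subst hbot
    obtain ⟨g⟩ : Nonempty (Fin k ↪ (A ∩ B).toFinset) := by
      rw [Function.Embedding.nonempty_iff_card_le]
      simp only [Fintype.card_fin, Fintype.card_coe]
      refine h _ fun a ha b hb p => ?_
      cases p with
      | nil => exact ⟨a, by simp, by simp [ha, hb]⟩
      | cons h _ => exact absurd h (by simp)
    have hg : ∀ i, (g i : V) ∈ A ∩ B := fun i => by simpa using (g i).2
    refine ⟨fun i => g i, fun i => g i, fun i => .nil, fun i => ⟨(hg i).1, (hg i).2, .nil⟩, ?_⟩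
    intro i j v hi hj
    simp only [Walk.support_nil, List.mem_singleton] at hi hj
    exact g.injective (Subtype.ext (hi ▸ hj))
  obtain ⟨x₀, y₀, he₀⟩ : ∃ x y, G.Adj x y := by
    by_contra! hcon
    exact hbot (by ext u v; simp [hcon])
  have hlt : (G.deleteEdges {s(x₀, y₀)}).edgeSet.ncard < n := by
    rw [← hn]
    refine Set.ncard_lt_ncard (edgeSet_ssubset_edgeSet.2 (lt_of_le_of_ne (deleteEdges_le _) ?_))
    intro heq
    rw [← heq] at he₀
    simp at he₀
  have hle : G.deleteEdges {s(x₀, y₀)} ≤ G := deleteEdges_le _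
  have hG' : ∀ u v, G.Adj u v → s(u, v) ≠ s(x₀, y₀) → (G.deleteEdges {s(x₀, y₀)}).Adj u v := by
    intro u v huv hne
    simp [deleteEdges_adj, huv, hne]
  generalize G.deleteEdges {s(x₀, y₀)} = G' at hlt hle hG'
  by_cases hall : ∀ S : Finset V, G'.Separates A B S → k ≤ S.card
  · exact (ih _ hlt G' A B hall rfl).mono hle
  push Not at hall
  obtain ⟨S, hS, hSk⟩ := hall
  obtain ⟨x, y, he, hxy, ⟨a₀, ha₀, pa, hpa⟩, b₀, hb₀, pb, hpb⟩ :=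
    hS.exists_walks hG' (fun hcon => absurd (h S hcon) (by omega))
  rw [← hxy] at hG'
  have hxS : x ∉ S := hpa x pa.end_mem_support
  have hyS : y ∉ S := hpb y pb.start_mem_support
  have hsep : ∀ z, z = x ∨ z = y → G.Separates A B (insert z S) := by
    intro z hz a ha b hb p
    rcases p.exists_walk_or_mem hG' with ⟨q, hq⟩ | ⟨h1, h2⟩
    · obtain ⟨v, hv, hvS⟩ := hS a ha b hb q
      exact ⟨v, hq ▸ hv, by simp [hvS]⟩
    · rcases hz with rfl | rfl
      · exact ⟨z, h1, by simp⟩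
      · exact ⟨z, h2, by simp⟩
  have hcard : S.card + 1 = k := by
    have := h _ (hsep x (.inl rfl))
    rw [Finset.card_insert_of_notMem hxS] at this
    omega
  have hcx : (insert x S).card = k := by rw [Finset.card_insert_of_notMem hxS, hcard]
  have hcy : (insert y S).card = k := by rw [Finset.card_insert_of_notMem hyS, hcard]
  obtain ⟨s, p, hp, hpd⟩ := (ih _ hlt G' A (insert x S : Finset V)
    (fun T hT => h T (hS.of_insert hG' hb₀ pb hpb hT)) rfl).exists_paths hcx
  obtain ⟨t, q, hq, hqd⟩ := (ih _ hlt G' B (insert y S : Finset V) (fun T hT => by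
    refine h T (Separates.symm ?_)
    rw [Sym2.eq_swap] at hG'
    exact hS.symm.of_insert hG' ha₀ pa.reverse (by simpa using hpa) hT) rfl).exists_paths hcy
  have hp1 : ∀ (i : (insert x S : Finset V)) v, v ∈ (p i).support → v ∈ insert x S → v = i := by
    intro i v hv hvS
    exact (congrArg Subtype.val (hpd i ⟨v, hvS⟩ v hv (p ⟨v, hvS⟩).end_mem_support)).symm
  have hq1 : ∀ (i : (insert y S : Finset V)) v, v ∈ (q i).support → v ∈ insert y S → v = i := by
    intro i v hv hvS
    exact (congrArg Subtype.val (hqd i ⟨v, hvS⟩ v hv (q ⟨v, hvS⟩).end_mem_support)).symm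
  have hmeet : ∀ i j v, v ∈ (p i).support → v ∈ (q j).support → v ∈ S := by
    intro i j v hvp hvq
    obtain ⟨z, hz, hzS⟩ := hS _ (hp i).1 _ (hq j).1
      (((p i).takeUntil v hvp).append ((q j).takeUntil v hvq).reverse)
    rcases (Walk.mem_support_append_iff _ _).1 hz with hz | hz
    · have hzi := hp1 i z ((p i).support_takeUntil_subset_support hvp hz) (by simp [hzS])
      by_cases hvi : v = i
      · exact hvi ▸ hzi ▸ hzS
      · exact absurd (hzi ▸ hz) (Walk.endpoint_notMem_support_takeUntil (hp i).2 hvp (Ne.symm hvi))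
    · rw [Walk.support_reverse, List.mem_reverse] at hz
      have hzi := hq1 j z ((q j).support_takeUntil_subset_support hvq hz) (by simp [hzS])
      by_cases hvi : v = j
      · exact hvi ▸ hzi ▸ hzS
      · exact absurd (hzi ▸ hz) (Walk.endpoint_notMem_support_takeUntil (hq j).2 hvq (Ne.symm hvi))
  let f : ↥(insert x S) → ↥(insert y S) := fun i =>
    if hi : (i : V) ∈ S then ⟨i, by simp [hi]⟩ else ⟨y, by simp⟩
  have hf : ∀ i, (f i : V) ∈ S → (f i : V) = i := by
    intro i hi
    by_cases h : (i : V) ∈ S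
    · simp [f, h]
    · simp [f, h, hyS] at hi
  have hfinj : Function.Injective f := by
    intro i j hij
    have hi := i.2
    have hj := j.2
    simp only [Finset.mem_insert] at hi hj
    by_cases h1 : (i : V) ∈ S <;> by_cases h2 : (j : V) ∈ S <;> simp [f, h1, h2] at hij
    · exact hij
    · exact absurd (hij ▸ h1) hyS
    · exact absurd (hij ▸ h2) hyS
    · exact Subtype.ext ((hi.resolve_right h1).trans (hj.resolve_right h2).symm)
  have hr : ∀ i, ∃ r : G.Walk (s i) (t (f i)), r.IsPath ∧
      ∀ v ∈ r.support, v ∈ (p i).support ∨ v ∈ (q (f i)).support := by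
    intro i
    suffices ∃ r : G.Walk (s i) (t (f i)),
        ∀ v ∈ r.support, v ∈ (p i).support ∨ v ∈ (q (f i)).support by
      obtain ⟨r, hr⟩ := this
      exact ⟨r.bypass, r.bypass_isPath, fun v hv => hr v (r.support_bypass_subset_support hv)⟩
    by_cases hi : (i : V) ∈ S
    · have hfi : (f i : V) = i := by simp [f, hi]
      refine ⟨((p i).mapLe hle).append ((((q (f i)).mapLe hle).reverse).copy hfi rfl), ?_⟩
      intro v hv
      simpa using hv
    · have hfi : (f i : V) = y := by simp [f, hi]
      have hix : (i : V) = x := (Finset.mem_insert.1 i.2).resolve_right hi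
      have hadj : G.Adj (i : V) (f i : V) := by rw [hfi, hix]; exact he
      refine ⟨(((p i).mapLe hle).concat hadj).append ((q (f i)).mapLe hle).reverse, ?_⟩
      intro v hv
      simp [Walk.support_concat] at hv
      rcases hv with (hv | rfl) | hv
      · exact .inl hv
      · exact .inr (q (f i)).end_mem_support
      · exact .inr hv
  choose r hrp hr using hr
  obtain ⟨e⟩ : Nonempty (Fin k ≃ (insert x S : Finset V)) :=
    Fintype.card_eq.1 (by rw [Fintype.card_coe, hcx, Fintype.card_fin])
  refine ⟨fun i => s (e i), fun i => t (f (e i)), fun i => r (e i),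
    fun i => ⟨(hp _).1, (hq _).1, hrp _⟩, ?_⟩
  have hcross : ∀ i j v, v ∈ (p i).support → v ∈ (q (f j)).support → i = j := by
    intro i j v hvp hvq
    have hvS := hmeet i (f j) v hvp hvq
    have h1 := hp1 i v hvp (by simp [hvS])
    have h2 := hq1 (f j) v hvq (by simp [hvS])
    exact Subtype.ext (h1.symm.trans (h2.trans (hf j (h2 ▸ hvS))))
  intro i j v hi hj
  refine e.injective ?_
  rcases hr _ v hi with hi | hi <;> rcases hr _ v hj with hj | hj
  · exact hpd _ _ v hi hj
  · exact hcross _ _ v hi hj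
  · exact (hcross _ _ v hj hi).symm
  · exact hfinj (hqd _ _ v hi hj)

/-- There is a path of `G` from `x` to `y` whose set of internal vertices is `I`. -/
def SimpleGraph.Arc (G : SimpleGraph V) (x y : V) (I : Set V) : Prop :=
  ∃ p : G.Walk x y, p.IsPath ∧ ∀ v, v ∈ I ↔ v ∈ p.support ∧ v ≠ x ∧ v ≠ y

theorem SimpleGraph.Arc.symm {G : SimpleGraph V} {x y : V} {I : Set V} (h : G.Arc x y I) :
    G.Arc y x I := by
  obtain ⟨p, hp, hI⟩ := h
  exact ⟨p.reverse, hp.reverse, fun v => by simp [hI, and_comm]⟩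

/-- Splitting an arc at an internal vertex. -/
theorem SimpleGraph.Arc.split {G : SimpleGraph V} {x y z : V} {I : Set V} (h : G.Arc x y I)
    (hz : z ∈ I) : ∃ J K, G.Arc x z J ∧ G.Arc z y K ∧ Disjoint J K ∧
      ∀ v, v ∈ I ↔ v = z ∨ v ∈ J ∨ v ∈ K := by
  classical
  obtain ⟨p, hp, hI⟩ := h
  obtain ⟨hzp, hzx, hzy⟩ := (hI z).1 hz
  obtain ⟨q, r, rfl⟩ := Walk.mem_support_iff_exists_append.1 hzp
  have hq := hp.of_append_left
  have hr := hp.of_append_right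
  have hdis : ∀ v, v ∈ q.support → v ∈ r.support → v = z := by
    intro v h1 h2
    by_contra hne
    have hnd := hp.support_nodup
    rw [Walk.support_append, List.nodup_append] at hnd
    have : v ∈ r.support.tail := by
      rcases (Walk.mem_support_iff r).1 h2 with h | h
      · exact absurd h hne
      · exact h
    exact hnd.2.2 v h1 v this rfl
  refine ⟨{v | v ∈ q.support ∧ v ≠ x ∧ v ≠ z}, {v | v ∈ r.support ∧ v ≠ z ∧ v ≠ y},
    ⟨q, hq, fun v => Iff.rfl⟩, ⟨r, hr, fun v => Iff.rfl⟩, ?_, ?_⟩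
  · rw [Set.disjoint_left]
    rintro v ⟨h1, -, h2⟩ ⟨h3, -⟩
    exact h2 (hdis v h1 h3)
  · intro v
    have hx : x ∈ r.support → x = z := fun h => hdis x q.start_mem_support h
    have hy : y ∈ q.support → y = z := fun h => hdis y h r.end_mem_support
    simp only [hI, Walk.mem_support_append_iff, Set.mem_ofPred_eq]
    have := q.end_mem_support
    grind

/-- A walk contains an arc between its ends. -/
theorem SimpleGraph.Walk.exists_arc {G : SimpleGraph V} {x y : V} (p : G.Walk x y) :
    ∃ I, G.Arc x y I ∧ ∀ v ∈ I, v ∈ p.support ∧ v ≠ x ∧ v ≠ y := by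
  classical
  exact ⟨{v | v ∈ p.bypass.support ∧ v ≠ x ∧ v ≠ y}, ⟨p.bypass, p.bypass_isPath, fun v => Iff.rfl⟩,
    fun v hv => ⟨p.support_bypass_subset_support hv.1, hv.2⟩⟩

/-- The graph obtained from `G` by deleting `w` and mapping the other vertices along `φ`. -/
def SimpleGraph.contractDelete (G : SimpleGraph V) (w : V) (φ : V → V) : SimpleGraph V where
  Adj u v := u ≠ v ∧ u ≠ w ∧ v ≠ w ∧ ∃ u₀ v₀, G.Adj u₀ v₀ ∧ φ u₀ = u ∧ φ v₀ = v
  symm := ⟨fun _ _ ⟨h, hu, hv, u₀, v₀, ha, h₁, h₂⟩ => ⟨h.symm, hv, hu, v₀, u₀, ha.symm, h₂, h₁⟩⟩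
  loopless := ⟨fun _ h => h.1 rfl⟩

theorem SimpleGraph.Walk.exists_contractDelete {G : SimpleGraph V} {w : V} {φ : V → V}
    {x y : V} (p : G.Walk x y) (hp : ∀ v ∈ p.support, φ v ≠ w) :
    ∃ q : (G.contractDelete w φ).Walk (φ x) (φ y), ∀ v ∈ q.support, ∃ u ∈ p.support, φ u = v := by
  induction p with
  | nil => exact ⟨.nil, by simp⟩
  | @cons a b c hab p ih =>
    obtain ⟨q, hq⟩ := ih fun v hv => hp v (by simp [hv])
    by_cases h : φ a = φ b
    · rw [h]
      exact ⟨q, fun v hv => (hq v hv).imp fun u hu => ⟨by simp [hu.1], hu.2⟩⟩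
    · have hadj : (G.contractDelete w φ).Adj (φ a) (φ b) :=
        ⟨h, hp a (by simp), hp b (by simp), a, b, hab, rfl, rfl⟩
      refine ⟨.cons hadj q, ?_⟩
      intro v hv
      rw [Walk.support_cons, List.mem_cons] at hv
      rcases hv with rfl | hv
      · exact ⟨a, by simp, rfl⟩
      · exact (hq v hv).imp fun u hu => ⟨by simp [hu.1], hu.2⟩

theorem SimpleGraph.Walk.ne_and_mem_range_of_contractDelete {G : SimpleGraph V} {w : V} {φ : V → V}
    {x y : V} (p : (G.contractDelete w φ).Walk x y) (hx : x ≠ w ∧ x ∈ Set.range φ) :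
    ∀ v ∈ p.support, v ≠ w ∧ v ∈ Set.range φ := by
  induction p with
  | nil => simpa using hx
  | @cons a b c hab p ih =>
    intro v hv
    rw [Walk.support_cons, List.mem_cons] at hv
    rcases hv with rfl | hv
    · exact hx
    · obtain ⟨-, -, hb, -, v₀, -, -, h⟩ := hab
      exact ih ⟨hb, v₀, h⟩ v hv

/-- A walk of the contracted graph avoiding the contracted vertex is a walk of `G`. -/
theorem SimpleGraph.Walk.exists_of_contractDelete {G : SimpleGraph V} {w t : V} {φ : V → V}
    (hφ : ∀ v, φ v ≠ t → φ v = v) {x y : V} (p : (G.contractDelete w φ).Walk x y)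
    (hp : t ∉ p.support) : ∃ q : G.Walk x y, ∀ v ∈ q.support, v ∈ p.support := by
  induction p with
  | nil => exact ⟨.nil, by simp⟩
  | @cons a b c hab p ih =>
    rw [Walk.support_cons, List.mem_cons, not_or] at hp
    obtain ⟨q, hq⟩ := ih hp.2
    have hb : b ≠ t := fun h => hp.2 (h ▸ p.start_mem_support)
    have hadj : G.Adj a b := by
      obtain ⟨-, -, -, u, v, huv, rfl, rfl⟩ := hab
      rwa [hφ u (Ne.symm hp.1), hφ v hb]
    refine ⟨.cons hadj q, ?_⟩
    simp only [Walk.support_cons, List.mem_cons]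
    exact fun z hz => hz.imp id (hq z)

/-- A path of the contracted graph to the contracted vertex lifts to a walk of `G` to one of its
preimages. -/
theorem SimpleGraph.Walk.IsPath.exists_of_contractDelete {G : SimpleGraph V} {w t : V} {φ : V → V}
    (hφ : ∀ v, φ v ≠ t → φ v = v) {x : V} (p : (G.contractDelete w φ).Walk (φ x) t)
    (hp : p.IsPath) : ∃ y, φ y = t ∧ ∃ q : G.Walk x y,
      ∀ v ∈ q.support, v = y ∨ v ∈ p.support ∧ v ≠ t := by
  by_cases hx : φ x = t
  · exact ⟨x, hx, .nil, by simp⟩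
  have hp' := hp.reverse
  have hsupp : ∀ v, v ∈ p.reverse.support → v ∈ p.support := by simp
  generalize p.reverse = r at hp' hsupp
  cases r with
  | nil => exact absurd rfl hx
  | @cons _ z _ hadj r =>
    obtain ⟨hr, htr⟩ := (Walk.cons_isPath_iff _ _).1 hp'
    have hz : z ≠ t := fun h => htr (h ▸ r.start_mem_support)
    obtain ⟨y, hyz, hy⟩ : ∃ y, G.Adj y z ∧ φ y = t := by
      obtain ⟨-, -, -, y, z₀, hyz, hy, rfl⟩ := hadj
      exact ⟨y, by rwa [hφ z₀ hz], hy⟩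
    obtain ⟨q, hq⟩ := Walk.exists_of_contractDelete hφ r htr
    refine ⟨y, hy, ((q.copy rfl (hφ x hx)).cons hyz).reverse, ?_⟩
    intro v hv
    simp only [Walk.support_reverse, List.mem_reverse, Walk.support_cons, List.mem_cons,
      Walk.support_copy] at hv
    refine hv.imp id fun h => ⟨hsupp v ?_, fun h' => htr (h' ▸ hq v h)⟩
    simp [hq v h]

theorem SimpleGraph.ThreeConnected.exists_isPath_notMem [Fintype V] {G : SimpleGraph V}
    (hG : G.ThreeConnected) {S : Finset V} {x y : V} (hS : S.card ≤ 2) (hx : x ∉ S) (hy : y ∉ S) :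
    ∃ p : G.Walk x y, p.IsPath ∧ ∀ v ∈ p.support, v ∉ S := by
  classical
  have hconn := hG.2 S (by rwa [Set.ncard_coe_finset])
  obtain ⟨p⟩ := hconn.preconnected ⟨x, hx⟩ ⟨y, hy⟩
  suffices ∀ (x y : ((S : Set V)ᶜ : Set V)) (p : (G.induce (S : Set V)ᶜ).Walk x y),
      ∃ q : G.Walk x y, ∀ v ∈ q.support, v ∉ S by
    obtain ⟨q, hq⟩ := this _ _ p
    exact ⟨q.bypass, q.bypass_isPath, fun v hv => hq v (q.support_bypass_subset_support hv)⟩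
  intro x y p
  induction p with
  | @nil a => exact ⟨.nil, by
      simp only [Walk.support_nil, List.mem_singleton, forall_eq]
      exact a.2⟩
  | @cons a b c h p ih =>
    obtain ⟨q, hq⟩ := ih
    have h' : G.Adj a b := h
    refine ⟨q.cons h', fun v hv => ?_⟩
    rw [Walk.support_cons, List.mem_cons] at hv
    rcases hv with rfl | hv
    · exact a.2
    · exact hq v hv

/-- Three paths from an internal vertex `w` of an arc off `R`, to the two ends of the arc and to a
third vertex of `R`. -/
theorem SimpleGraph.ThreeConnected.exists_fan [Fintype V] {G : SimpleGraph V}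
    (hG : G.ThreeConnected) {R I : Set V} {a b w t : V} (hI : G.Arc a b I) (hwI : w ∈ I)
    (hIR : Disjoint I R) (ha : a ∈ R) (hb : b ∈ R) (hab : a ≠ b) (ht : t ∈ R) (hta : t ≠ a)
    (htb : t ≠ b) :
    ∃ y ∈ R, y ≠ a ∧ y ≠ b ∧ ∃ J₁ J₂ J₃, G.Arc w a J₁ ∧ G.Arc w b J₂ ∧ G.Arc w y J₃ ∧
      Disjoint J₁ J₂ ∧ Disjoint J₁ J₃ ∧ Disjoint J₂ J₃ ∧
      Disjoint J₁ R ∧ Disjoint J₂ R ∧ Disjoint J₃ R := by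
  classical
  rw [Set.disjoint_left] at hIR
  have hw : w ∉ R := hIR hwI
  have hwt : w ≠ t := fun h => hw (h ▸ ht)
  have hwa : w ≠ a := fun h => hw (h ▸ ha)
  have hwb : w ≠ b := fun h => hw (h ▸ hb)
  let φ : V → V := fun v => if v ∈ R ∧ v ≠ a ∧ v ≠ b then t else v
  have hφ : ∀ v, φ v ≠ t → φ v = v := by
    intro v hv
    by_cases h : v ∈ R ∧ v ≠ a ∧ v ≠ b
    · simp [φ, h] at hv
    · simp [φ, h]
  have hφR : ∀ v, φ v = t → v ∈ R ∧ v ≠ a ∧ v ≠ b := by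
    intro v hv
    by_contra h
    have : v = t := by simpa [φ, h] using hv
    exact h (this ▸ ⟨ht, hta, htb⟩)
  have hφw : ∀ v, v ≠ w → φ v ≠ w := by
    intro v hv h
    rcases eq_or_ne (φ v) t with h' | h'
    · exact hwt (h.symm.trans h')
    · exact hv ((hφ v h').symm.trans h)
  -- a path of `G` starting at `w` yields a walk of the contracted graph from a neighbour of `w`
  have hproj : ∀ z (p : G.Walk w z), p.IsPath → z ≠ w → φ z = z →
      ∀ S : Finset V, (G.contractDelete w φ).Separates (φ '' {x | G.Adj w x})
        (({a, b, t} : Finset V) : Set V) S → z ∈ ({a, b, t} : Finset V) →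
        ∃ u ∈ p.support, u ≠ w ∧ φ u ∈ S := by
    intro z p hp hzw hz S hS hzT
    cases p with
    | nil => exact absurd rfl hzw
    | @cons _ x _ hwx p =>
      obtain ⟨hp, hwp⟩ := (Walk.cons_isPath_iff _ _).1 hp
      have hne : ∀ v ∈ p.support, v ≠ w := fun v hv h => hwp (h ▸ hv)
      obtain ⟨q, hq⟩ := p.exists_contractDelete fun v hv => hφw v (hne v hv)
      obtain ⟨v, hv, hvS⟩ := hS (φ x) ⟨x, hwx, rfl⟩ (φ z) (by rw [hz]; exact hzT) q
      obtain ⟨u, hu, rfl⟩ := hq v hv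
      exact ⟨u, by simp [hu], hne u hu, hvS⟩
  have hmenger : (G.contractDelete w φ).HasLinkage (φ '' {x | G.Adj w x})
      (({a, b, t} : Finset V) : Set V) 3 := by
    refine hasLinkage_of_separates 3 _ _ _ fun S hS => ?_
    by_contra! hcard
    by_cases htS : t ∈ S
    · obtain ⟨J, K, ⟨p, hp, hJ⟩, ⟨q, hq, hK⟩, hJK, hIJK⟩ := hI.split hwI
      obtain ⟨u, hu, huw, huS⟩ := hproj a p.reverse hp.reverse hwa.symm (by simp [φ]) S hS (by simp)
      obtain ⟨v, hv, hvw, hvS⟩ := hproj b q hq hwb.symm (by simp [φ]) S hS (by simp)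
      rw [Walk.support_reverse, List.mem_reverse] at hu
      rw [Set.disjoint_left] at hJK
      have hbJ : b ∉ J := fun h => hIR ((hIJK b).2 (.inr (.inl h))) hb
      have haK : a ∉ K := fun h => hIR ((hIJK a).2 (.inr (.inr h))) ha
      have hu' : u = a ∨ u ∈ J := or_iff_not_imp_left.2 fun h => (hJ u).2 ⟨hu, h, huw⟩
      have hv' : v = b ∨ v ∈ K := or_iff_not_imp_left.2 fun h => (hK v).2 ⟨hv, hvw, h⟩
      have huφ : φ u ≠ t := by
        intro h
        obtain ⟨h1, h2, h3⟩ := hφR u h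
        rcases hu' with h | h
        · exact h2 h
        · exact hIR ((hIJK u).2 (.inr (.inl h))) h1
      have hvφ : φ v ≠ t := by
        intro h
        obtain ⟨h1, h2, h3⟩ := hφR v h
        rcases hv' with h | h
        · exact h3 h
        · exact hIR ((hIJK v).2 (.inr (.inr h))) h1
      have huv : u ≠ v := by
        rintro rfl
        rcases hu' with h | h <;> rcases hv' with h' | h'
        · exact hab (h.symm.trans h')
        · exact haK (h ▸ h')
        · exact hbJ (h' ▸ h)
        · exact hJK h h'
      have hsub : ({t, u, v} : Finset V) ⊆ S := by
        rw [hφ u huφ] at huS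
        rw [hφ v hvφ] at hvS
        simp [Finset.insert_subset_iff, htS, huS, hvS]
      rw [hφ u huφ] at huφ
      rw [hφ v hvφ] at hvφ
      have := Finset.card_le_card hsub
      rw [Finset.card_eq_three.2 ⟨t, u, v, huφ.symm, hvφ.symm, huv, rfl⟩] at this
      omega
    · obtain ⟨p, hp, hpS⟩ := hG.exists_isPath_notMem (S := S.erase w) (x := w) (y := t)
        (by have := Finset.card_erase_le (s := S) (a := w); omega) (by simp) (by simp [htS])
      obtain ⟨u, hu, huw, huS⟩ := hproj t p hp hwt.symm (by simp [φ]) S hS (by simp)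
      rcases eq_or_ne (φ u) t with h | h
      · exact htS (h ▸ huS)
      · exact hpS u hu (Finset.mem_erase.2 ⟨huw, hφ u h ▸ huS⟩)
  obtain ⟨s, p, hp, hdis⟩ := hmenger.exists_paths
    (Finset.card_eq_three.2 ⟨a, b, t, hab, hta.symm, htb.symm, rfl⟩)
  let ta : ({a, b, t} : Finset V) := ⟨a, by simp⟩
  let tb : ({a, b, t} : Finset V) := ⟨b, by simp⟩
  let tt : ({a, b, t} : Finset V) := ⟨t, by simp⟩
  have hsource : ∀ z, ∃ x, G.Adj w x ∧ φ x = s z := fun z => (hp z).1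
  have hoff : ∀ z, ∀ v ∈ (p z).support, v ≠ w ∧ (v ∈ R → v = a ∨ v = b ∨ v = t) := by
    intro z v hv
    obtain ⟨x, hwx, hx⟩ := hsource z
    obtain ⟨hvw, u, hu⟩ := (p z).ne_and_mem_range_of_contractDelete
      ⟨hx ▸ hφw x hwx.ne', x, hx⟩ v hv
    refine ⟨hvw, fun hvR => ?_⟩
    by_contra! h
    have huv : u = v := (hφ u (hu ▸ h.2.2)).symm.trans hu
    subst huv
    exact h.2.2 (by simp [φ, hvR, h.1, h.2.1] at hu; exact hu.symm)
  have hend : ∀ z, z ≠ tt → ∃ q : G.Walk w z, ∀ v ∈ q.support, v = w ∨ v ∈ (p z).support := by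
    intro z hz
    have htz : t ∉ (p z).support := fun h => hz (hdis z tt t h (p tt).end_mem_support)
    obtain ⟨x, hwx, hx⟩ := hsource z
    have hxt : φ x ≠ t := fun h => htz <|
      Eq.subst (motive := fun v => v ∈ (p z).support) (hx.symm.trans h) (p z).start_mem_support
    obtain ⟨q, hq⟩ := Walk.exists_of_contractDelete hφ (p z) htz
    have hwx' : G.Adj w (s z) := by rwa [← hx, hφ x hxt]
    refine ⟨q.cons hwx', fun v hv => ?_⟩
    rw [Walk.support_cons, List.mem_cons] at hv
    exact hv.imp id (hq v)
  have hmem : ∀ z z' v, v ∈ (p z).support → v ∈ (p z').support → (z : V) = z' :=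
    fun z z' v h h' => congrArg _ (hdis z z' v h h')
  obtain ⟨qa, hqa⟩ := hend ta (fun h => hta (congrArg Subtype.val h).symm)
  obtain ⟨qb, hqb⟩ := hend tb (fun h => htb (congrArg Subtype.val h).symm)
  obtain ⟨x, hwx, hx⟩ := hsource tt
  obtain ⟨y, hy, qy, hqy⟩ := Walk.IsPath.exists_of_contractDelete hφ
    ((p tt).copy hx.symm rfl) ((Walk.isPath_copy _ _ _).2 (hp tt).2)
  obtain ⟨hyR, hya, hyb⟩ := hφR y hy
  obtain ⟨J₁, hJ₁, hJ₁'⟩ := qa.exists_arc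
  obtain ⟨J₂, hJ₂, hJ₂'⟩ := qb.exists_arc
  obtain ⟨J₃, hJ₃, hJ₃'⟩ := (qy.cons hwx).exists_arc
  have h₁ : ∀ v ∈ J₁, v ∈ (p ta).support ∧ v ≠ a := fun v hv =>
    ⟨(hqa v (hJ₁' v hv).1).resolve_left (hJ₁' v hv).2.1, (hJ₁' v hv).2.2⟩
  have h₂ : ∀ v ∈ J₂, v ∈ (p tb).support ∧ v ≠ b := fun v hv =>
    ⟨(hqb v (hJ₂' v hv).1).resolve_left (hJ₂' v hv).2.1, (hJ₂' v hv).2.2⟩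
  have h₃ : ∀ v ∈ J₃, v ∈ (p tt).support ∧ v ≠ t := by
    intro v hv
    obtain ⟨h, hvw, hvy⟩ := hJ₃' v hv
    rw [Walk.support_cons, List.mem_cons] at h
    simpa using (hqy v (h.resolve_left hvw)).resolve_left hvy
  have hpa : a ∈ (p ta).support := (p ta).end_mem_support
  have hpb : b ∈ (p tb).support := (p tb).end_mem_support
  have hpt : t ∈ (p tt).support := (p tt).end_mem_support
  refine ⟨y, hyR, hya, hyb, J₁, J₂, J₃, hJ₁, hJ₂, hJ₃, ?_, ?_, ?_, ?_, ?_, ?_⟩ <;>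
    rw [Set.disjoint_left]
  · exact fun v h h' => hab (hmem ta tb v (h₁ v h).1 (h₂ v h').1)
  · exact fun v h h' => hta.symm (hmem ta tt v (h₁ v h).1 (h₃ v h').1)
  · exact fun v h h' => htb.symm (hmem tb tt v (h₂ v h).1 (h₃ v h').1)
  · intro v h hR
    obtain ⟨hv, hne⟩ := h₁ v h
    rcases (hoff ta v hv).2 hR with rfl | rfl | rfl
    · exact hne rfl
    · exact hab (hmem ta tb _ hv hpb)
    · exact hta.symm (hmem ta tt _ hv hpt)
  · intro v h hR
    obtain ⟨hv, hne⟩ := h₂ v h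
    rcases (hoff tb v hv).2 hR with rfl | rfl | rfl
    · exact hab.symm (hmem tb ta _ hv hpa)
    · exact hne rfl
    · exact htb.symm (hmem tb tt _ hv hpt)
  · intro v h hR
    obtain ⟨hv, hne⟩ := h₃ v h
    rcases (hoff tt v hv).2 hR with rfl | rfl | rfl
    · exact hta (hmem tt ta _ hv hpa)
    · exact htb (hmem tt tb _ hv hpb)
    · exact hne rfl

/-- A drawing in `G` of a subdivision of the graph with vertex set `S` and edge set `E`: the vertex
`i ∈ S` is drawn as `P i`, and `c` labels `P i` by `(i, i)`, the internal vertices of the path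
drawing the edge `e` by `e`, and all vertices outside of the drawing by `(0, 0)`. -/
structure SimpleGraph.IsDrawing (G : SimpleGraph V) (c : V → ℕ × ℕ) (P : ℕ → V) (S : List ℕ)
    (E : List (ℕ × ℕ)) : Prop where
  pos : ∀ i ∈ S, 0 < i
  point : ∀ i ∈ S, ∀ v, c v = (i, i) ↔ v = P i
  edge : ∀ e ∈ E, e.1 < e.2 ∧ e.1 ∈ S ∧ e.2 ∈ S
  arc : ∀ e ∈ E, G.Arc (P e.1) (P e.2) {v | c v = e}
  cover : ∀ v, c v = (0, 0) ∨ (∃ i ∈ S, c v = (i, i)) ∨ c v ∈ E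

namespace SimpleGraph.IsDrawing

variable {G : SimpleGraph V} {c : V → ℕ × ℕ} {P : ℕ → V} {S : List ℕ} {E : List (ℕ × ℕ)}

theorem removeEdge (h : G.IsDrawing c P S E) {e : ℕ × ℕ} (he : e ∈ E) :
    G.IsDrawing (fun v => if c v = e then (0, 0) else c v) P S (E.filter (· ≠ e)) where
  pos := h.pos
  point i hi v := by
    have := h.point i hi v
    have := h.pos i hi
    have := h.edge e he
    grind
  edge f hf := h.edge f (List.mem_of_mem_filter hf)
  arc f hf := by
    have hfE := List.mem_of_mem_filter hf
    have := h.edge f hfE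
    have hfe : f ≠ e := by simpa [hfE] using hf
    convert h.arc f hfE using 3 with v
    grind
  cover v := by
    have := h.cover v
    grind

theorem addPoint [DecidableEq V] (h : G.IsDrawing c P S E) {m : ℕ} {w : V} (hm : 0 < m)
    (hmS : m ∉ S) (hw : c w = (0, 0)) :
    G.IsDrawing (Function.update c w (m, m)) (Function.update P m w) (m :: S) E where
  pos i hi := by
    have := h.pos
    grind
  point i hi v := by
    have := h.point
    have := h.cover v
    have := h.edge
    have := h.pos
    grind
  edge e he := by
    have := h.edge e he
    grind
  arc e he := by
    have := h.edge e he
    convert h.arc e he using 1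
    · grind
    · grind
    · ext v
      have : c v = e ↔ Function.update c w (m, m) v = e := by grind
      exact this.symm
  cover v := by
    have := h.cover v
    grind

theorem addEdge (h : G.IsDrawing c P S E) {i j : ℕ} {J : Set V} [DecidablePred (· ∈ J)]
    (hij : i < j) (hi : i ∈ S) (hj : j ∈ S) (hE : (i, j) ∉ E) (hJ : G.Arc (P i) (P j) J)
    (hJc : ∀ v ∈ J, c v = (0, 0)) :
    G.IsDrawing (fun v => if v ∈ J then (i, j) else c v) P S ((i, j) :: E) where
  pos := h.pos
  point k hk v := by
    have := h.point k hk v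
    have := h.pos k hk
    grind
  edge e he := by
    have := h.edge e
    grind
  arc e he := by
    rcases List.mem_cons.1 he with rfl | he
    · convert hJ
      ext v
      have := h.cover v
      have : (if v ∈ J then (i, j) else c v) = (i, j) ↔ v ∈ J := by grind
      exact this
    · have := h.edge e he
      convert h.arc e he using 3 with v
      grind
  cover v := by
    have := h.cover v
    grind

/-- Subdividing the edge `f` at the internal vertex `y` of the path drawing it. -/
theorem subdivide (h : G.IsDrawing c P S E) {f : ℕ × ℕ} (hf : f ∈ E) {n : ℕ}
    (hn : ∀ i ∈ S, i < n) {y : V} (hy : c y = f) :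
    ∃ c', G.IsDrawing c' (Function.update P n y) (n :: S)
      ((f.1, n) :: (f.2, n) :: E.filter (· ≠ f)) ∧ ∀ v, c v = (0, 0) ↔ c' v = (0, 0) := by
  classical
  obtain ⟨J, K, hJ, hK, hJK, hI⟩ := (h.arc f hf).split (z := y) hy
  rw [Set.disjoint_left] at hJK
  obtain ⟨hf₁, hf₂, hf₃⟩ := h.edge f hf
  have hn₁ := hn _ hf₂
  have hn₂ := hn _ hf₃
  have hI' : ∀ v, c v = f ↔ v = y ∨ v ∈ J ∨ v ∈ K := hI
  have hyJ : y ∉ J := fun h => by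
    obtain ⟨p, -, hp⟩ := hJ
    exact ((hp y).1 h).2.2 rfl
  have hyK : y ∉ K := fun h => by
    obtain ⟨p, -, hp⟩ := hK
    exact ((hp y).1 h).2.1 rfl
  have hE : ∀ e ∈ E, e.2 < n := fun e he => hn _ (h.edge e he).2.2
  have h₁ := (h.removeEdge hf).addPoint (m := n) (w := y) (by omega)
    (fun h => lt_irrefl _ (hn n h)) (by simp [hy])
  have h₂ := h₁.addEdge (i := f.2) (j := n) (J := K) hn₂ (by simp [hf₃]) (by simp)
    (by grind) (by
      rw [Function.update_of_ne hn₂.ne, Function.update_self]; exact hK.symm) (by grind)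
  have h₃ := h₂.addEdge (i := f.1) (j := n) (J := J) hn₁ (by simp [hf₂]) (by simp)
    (by grind) (by
      rw [Function.update_of_ne hn₁.ne, Function.update_self]; exact hJ) (by grind)
  exact ⟨_, h₃, by grind⟩

theorem injOn (h : G.IsDrawing c P S E) {i j : ℕ} (hi : i ∈ S) (hj : j ∈ S) (hij : P i = P j) :
    i = j := by
  have h₁ := (h.point i hi (P i)).2 rfl
  have h₂ := (h.point j hj (P i)).2 hij
  simpa using h₁.symm.trans h₂

/-- Adding a new vertex drawn as `w` together with edges to three old vertices. -/
theorem addFan [DecidableEq V] (h : G.IsDrawing c P S E) {i j k m : ℕ} {w : V} {J₁ J₂ J₃ : Set V}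
    (hi : i ∈ S) (hj : j ∈ S) (hk : k ∈ S) (hij : i ≠ j) (hik : i ≠ k) (hjk : j ≠ k)
    (hm : ∀ i ∈ S, i < m) (hw : c w = (0, 0))
    (h₁ : G.Arc w (P i) J₁) (h₂ : G.Arc w (P j) J₂) (h₃ : G.Arc w (P k) J₃)
    (h₁₂ : Disjoint J₁ J₂) (h₁₃ : Disjoint J₁ J₃) (h₂₃ : Disjoint J₂ J₃)
    (hc₁ : ∀ v ∈ J₁, c v = (0, 0)) (hc₂ : ∀ v ∈ J₂, c v = (0, 0)) (hc₃ : ∀ v ∈ J₃, c v = (0, 0)) :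
    ∃ c', G.IsDrawing c' (Function.update P m w) (m :: S)
      ((i, m) :: (j, m) :: (k, m) :: E) := by
  classical
  rw [Set.disjoint_left] at h₁₂ h₁₃ h₂₃
  have hwJ : ∀ z J, G.Arc w z J → w ∉ J := by
    rintro z J ⟨p, -, hp⟩ h
    exact ((hp w).1 h).2.1 rfl
  have hw₁ := hwJ _ _ h₁
  have hw₂ := hwJ _ _ h₂
  have hw₃ := hwJ _ _ h₃
  have hE : ∀ e ∈ E, e.2 < m := fun e he => hm _ (h.edge e he).2.2
  have hmi := hm i hi
  have hmj := hm j hj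
  have hmk := hm k hk
  have D₀ := h.addPoint (m := m) (w := w) (by omega) (fun h => lt_irrefl _ (hm m h)) hw
  have D₁ := D₀.addEdge (i := k) (j := m) (J := J₃) hmk (by simp [hk]) (by simp)
    (by grind) (by
      rw [Function.update_of_ne hmk.ne, Function.update_self]; exact h₃.symm) (by grind)
  have D₂ := D₁.addEdge (i := j) (j := m) (J := J₂) hmj (by simp [hj]) (by simp)
    (by grind) (by
      rw [Function.update_of_ne hmj.ne, Function.update_self]; exact h₂.symm) (by grind)
  have D₃ := D₂.addEdge (i := i) (j := m) (J := J₁) hmi (by simp [hi]) (by simp)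
    (by grind) (by
      rw [Function.update_of_ne hmi.ne, Function.update_self]; exact h₁.symm) (by grind)
  exact ⟨_, D₃⟩

/-- In a 3-connected graph, the path drawing an edge can be rerouted through any of its internal
vertices `w`, so that moreover `w` is linked to another vertex of the drawing or to an internal
vertex `y` of the path drawing another edge. -/
theorem exists_fan [Fintype V] [DecidableEq V] (hG : G.ThreeConnected) (h : G.IsDrawing c P S E)
    {e : ℕ × ℕ} (he : e ∈ E) {w : V} (hw : c w = e) (hS : ∃ k ∈ S, k ≠ e.1 ∧ k ≠ e.2) {m n : ℕ}
    (hn : ∀ i ∈ S, i < n) (hm : n < m) :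
    (∃ k ∈ S, k ≠ e.1 ∧ k ≠ e.2 ∧ ∃ c', G.IsDrawing c' (Function.update P m w) (m :: S)
      ((e.1, m) :: (e.2, m) :: (k, m) :: E.filter (· ≠ e))) ∨
    ∃ f ∈ E, f ≠ e ∧ ∃ y c',
      G.IsDrawing c' (Function.update (Function.update P n y) m w) (m :: n :: S)
        ((e.1, m) :: (e.2, m) :: (n, m) :: (f.1, n) :: (f.2, n) ::
          (E.filter (· ≠ e)).filter (· ≠ f)) := by
  obtain ⟨he₁, he₂, he₃⟩ := h.edge e he
  obtain ⟨t, ht, ht₁, ht₂⟩ := hS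
  have hcP : ∀ i ∈ S, c (P i) = (i, i) := fun i hi => (h.point i hi _).2 rfl
  have hne : ∀ i ∈ S, (i, i) ≠ ((0, 0) : ℕ × ℕ) ∧ (i, i) ≠ e := by
    intro i hi
    have := h.pos i hi
    grind
  have hR : ∀ i ∈ S, P i ∈ {v | c v ≠ (0, 0) ∧ c v ≠ e} := by
    intro i hi
    have := hcP i hi
    have := hne i hi
    constructor <;> grind
  obtain ⟨y, ⟨hy₀, hye⟩, hy₁, hy₂, J₁, J₂, J₃, h₁, h₂, h₃, h₁₂, h₁₃, h₂₃, hd₁, hd₂, hd₃⟩ :=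
    hG.exists_fan (h.arc e he) (w := w) hw
    (R := {v | c v ≠ (0, 0) ∧ c v ≠ e})
    (by rw [Set.disjoint_left]; exact fun v h h' => h'.2 h) (hR _ he₂) (hR _ he₃)
    (fun h' => he₁.ne (h.injOn he₂ he₃ h')) (hR t ht) (fun h' => ht₁ (h.injOn ht he₂ h'))
    (fun h' => ht₂ (h.injOn ht he₃ h'))
  have hout : ∀ J : Set V, Disjoint J {v | c v ≠ (0, 0) ∧ c v ≠ e} →
      ∀ v ∈ J, (if c v = e then (0, 0) else c v) = (0, 0) := by
    intro J hJ v hv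
    have h' : ¬ (c v ≠ (0, 0) ∧ c v ≠ e) := Set.disjoint_left.1 hJ hv
    grind
  have D := h.removeEdge he
  rcases (h.cover y).resolve_left hy₀ with ⟨k, hk, hyk⟩ | hyE
  · obtain rfl := (h.point k hk y).1 hyk
    have hk₁ : k ≠ e.1 := by rintro rfl; exact hy₁ rfl
    have hk₂ : k ≠ e.2 := by rintro rfl; exact hy₂ rfl
    exact .inl ⟨k, hk, hk₁, hk₂, D.addFan he₂ he₃ hk he₁.ne hk₁.symm hk₂.symm
      (fun i hi => (hn i hi).trans hm) (by simp [hw]) h₁ h₂ h₃ h₁₂ h₁₃ h₂₃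
      (hout _ hd₁) (hout _ hd₂) (hout _ hd₃)⟩
  · obtain ⟨c', D', hc'⟩ := D.subdivide (f := c y) (n := n) (y := y) (by simp [hyE, hye]) hn
      (by simp [hye])
    have hn₁ := (hn _ he₂).ne
    have hn₂ := (hn _ he₃).ne
    refine .inr ⟨c y, hyE, hye, y, D'.addFan (i := e.1) (j := e.2) (k := n) (by simp [he₂])
      (by simp [he₃]) (by simp) he₁.ne hn₁ hn₂ ?_ ((hc' w).1 (by simp [hw])) ?_ ?_ ?_ h₁₂ h₁₃ h₂₃
      ?_ ?_ ?_⟩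
    · intro i hi
      rcases List.mem_cons.1 hi with rfl | hi
      · exact hm
      · exact (hn i hi).trans hm
    · rwa [Function.update_of_ne hn₁]
    · rwa [Function.update_of_ne hn₂]
    · rwa [Function.update_self]
    · exact fun v hv => (hc' v).1 (hout _ hd₁ v hv)
    · exact fun v hv => (hc' v).1 (hout _ hd₂ v hv)
    · exact fun v hv => (hc' v).1 (hout _ hd₃ v hv)

end SimpleGraph.IsDrawing

/-- The edge of a drawing between two vertices, in the order used by `SimpleGraph.IsDrawing`. -/
def edgeKey (i j : ℕ) : ℕ × ℕ := (min i j, max i j)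

/-- The list `l` continues `x` to a walk to `y` along edges in `E`. -/
def IsRoute (E : List (ℕ × ℕ)) (x : ℕ) : List ℕ → ℕ → Prop
  | [], y => x = y
  | z :: l, y => edgeKey x z ∈ E ∧ IsRoute E z l y

instance (E : List (ℕ × ℕ)) (x : ℕ) (l : List ℕ) (y : ℕ) : Decidable (IsRoute E x l y) := by
  induction l generalizing x with
  | nil => exact inferInstanceAs (Decidable (x = y))
  | cons z l ih =>
    have := ih z
    exact inferInstanceAs (Decidable (_ ∧ _))

/-- The labels of the vertices and edges on the walk through `x` and the members of `l`. -/
def routeLabels (x : ℕ) : List ℕ → List (ℕ × ℕ)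
  | [] => [(x, x)]
  | z :: l => (x, x) :: edgeKey x z :: routeLabels z l

/-- The feet of a subdivision of `K_{3,3}`, and for any two feet on different sides the walk between
them. -/
structure HexModel where
  A : Fin 3 → ℕ
  B : Fin 3 → ℕ
  route : Fin 3 → Fin 3 → List ℕ

/-- `M` describes a subdivision of `K_{3,3}` in the graph with vertex set `S` and edge set `E`. -/
def HexModel.IsValid (M : HexModel) (S : List ℕ) (E : List (ℕ × ℕ)) : Prop :=
  (∀ i, M.A i ∈ S ∧ M.B i ∈ S) ∧ (∀ i j, M.A i ≠ M.B j) ∧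
    (∀ i j, M.A i = M.A j → i = j) ∧ (∀ i j, M.B i = M.B j → i = j) ∧
    (∀ i j, IsRoute E (M.A i) (M.route i j) (M.B j)) ∧
    ∀ i j i' j', (i, j) ≠ (i', j') → ∀ k ∈ routeLabels (M.A i) (M.route i j),
      k ∈ routeLabels (M.A i') (M.route i' j') →
        k = (M.A i, M.A i) ∧ i = i' ∨ k = (M.B j, M.B j) ∧ j = j'

set_option synthInstance.maxSize 512 in
instance (M : HexModel) (S : List ℕ) (E : List (ℕ × ℕ)) : Decidable (M.IsValid S E) :=
  inferInstanceAs (Decidable (_ ∧ _))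

/-- The number of pairs of feet of different colours. -/
def oddPairs (α β : Fin 3 → Bool) : ℕ :=
  (Finset.univ.filter fun p : Fin 3 × Fin 3 => α p.1 ≠ β p.2).card

theorem SimpleGraph.Hex.oddCount_eq {G : SimpleGraph V} (col : G.Coloring Bool) (H : G.Hex) :
    H.oddCount = oddPairs (fun i => col (H.fA i)) (fun j => col (H.fB j)) := by
  unfold Hex.oddCount oddPairs
  congr 1
  ext p
  rw [Finset.mem_filter, Finset.mem_filter, ← Nat.not_even_iff_odd, col.even_length_iff_congr,
    ← Bool.eq_iff_iff]

theorem SimpleGraph.IsDrawing.exists_walk {G : SimpleGraph V} {c : V → ℕ × ℕ} {P : ℕ → V}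
    {S : List ℕ} {E : List (ℕ × ℕ)} (h : G.IsDrawing c P S E) {x y : ℕ} {l : List ℕ} (hx : x ∈ S)
    (hl : IsRoute E x l y) :
    ∃ p : G.Walk (P x) (P y), ∀ v ∈ p.support, c v ∈ routeLabels x l := by
  induction l generalizing x with
  | nil =>
    obtain rfl : x = y := hl
    exact ⟨.nil, by simp [routeLabels, h.point x hx]⟩
  | cons z l ih =>
    obtain ⟨hxz, hl⟩ := hl
    have hz : z ∈ S := by
      obtain ⟨-, h₁, h₂⟩ := h.edge _ hxz
      simp only [edgeKey] at h₁ h₂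
      rcases le_total x z with hle | hle <;> simp [hle] at h₁ h₂ <;> assumption
    obtain ⟨q, hq⟩ := ih hz hl
    obtain ⟨p, hp⟩ : ∃ p : G.Walk (P x) (P z), ∀ v ∈ p.support,
        v = P x ∨ v = P z ∨ c v = edgeKey x z := by
      rcases le_total x z with hle | hle
      · have hk : edgeKey x z = (x, z) := by simp [edgeKey, hle]
        rw [hk] at hxz ⊢
        obtain ⟨p, -, hp⟩ := h.arc _ hxz
        refine ⟨p, fun v hv => ?_⟩
        by_contra! hne
        exact hne.2.2 ((hp v).2 ⟨hv, hne.1, hne.2.1⟩)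
      · have hk : edgeKey x z = (z, x) := by simp [edgeKey, hle]
        rw [hk] at hxz ⊢
        obtain ⟨p, -, hp⟩ := (h.arc _ hxz).symm
        refine ⟨p, fun v hv => ?_⟩
        by_contra! hne
        exact hne.2.2 ((hp v).2 ⟨hv, hne.1, hne.2.1⟩)
    refine ⟨p.append q, fun v hv => ?_⟩
    rw [Walk.mem_support_append_iff] at hv
    have hzl : (z, z) ∈ routeLabels z l := by cases l <;> simp [routeLabels]
    rcases hv with hv | hv
    · rcases hp v hv with rfl | rfl | hv
      · simp [routeLabels, (h.point x hx _).2 rfl]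
      · simp [routeLabels, (h.point z hz _).2 rfl, hzl]
      · simp [routeLabels, hv]
    · simp [routeLabels, hq v hv]

theorem SimpleGraph.IsDrawing.exists_hex {G : SimpleGraph V} {c : V → ℕ × ℕ} {P : ℕ → V}
    {S : List ℕ} {E : List (ℕ × ℕ)} (h : G.IsDrawing c P S E) {M : HexModel}
    (hM : M.IsValid S E) (col : G.Coloring Bool) {Q : ℕ → Bool} (hQ : ∀ i ∈ S, col (P i) = Q i) :
    ∃ H : G.Hex, H.oddCount = oddPairs (fun i => Q (M.A i)) (fun j => Q (M.B j)) := by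
  classical
  obtain ⟨hS, hAB, hA, hB, hr, hd⟩ := hM
  choose p hp using fun i j => h.exists_walk (hS i).1 (hr i j)
  refine ⟨⟨fun i => P (M.A i), fun j => P (M.B j), ?_, ?_, ?_, fun i j => (p i j).bypass,
    fun i j => (p i j).bypass_isPath, ?_⟩, ?_⟩
  · exact fun i j hij => hA i j (h.injOn (hS i).1 (hS j).1 hij)
  · exact fun i j hij => hB i j (h.injOn (hS i).2 (hS j).2 hij)
  · exact fun i j hij => hAB i j (h.injOn (hS i).1 (hS j).2 hij)
  · intro i j i' j' hne v hv hv'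
    refine (hd i j i' j' hne (c v) (hp i j v ((p i j).support_bypass_subset_support hv))
      (hp i' j' v ((p i' j').support_bypass_subset_support hv'))).imp ?_ ?_
    · exact fun h' => ⟨(h.point _ (hS i).1 v).1 h'.1, h'.2⟩
    · exact fun h' => ⟨(h.point _ (hS j).2 v).1 h'.1, h'.2⟩
  · rw [Hex.oddCount_eq col]
    congr 1
    · exact funext fun i => hQ _ (hS i).1
    · exact funext fun i => hQ _ (hS i).2

/-- The edges of `K_{3,3}` with sides `{1, 2, 3}` and `{4, 5, 6}`. -/
def hexEdges : List (ℕ × ℕ) :=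
  [(1, 4), (1, 5), (1, 6), (2, 4), (2, 5), (2, 6), (3, 4), (3, 5), (3, 6)]

/-- The foot of a hex with a given number. -/
def SimpleGraph.Hex.foot {G : SimpleGraph V} (H : G.Hex) : ℕ → V
  | 1 => H.fA 0
  | 2 => H.fA 1
  | 3 => H.fA 2
  | 4 => H.fB 0
  | 5 => H.fB 1
  | _ => H.fB 2

theorem SimpleGraph.Hex.foot_fA {G : SimpleGraph V} (H : G.Hex) (i : Fin 3) :
    H.foot (i.val + 1) = H.fA i := by
  fin_cases i <;> rfl

theorem SimpleGraph.Hex.foot_fB {G : SimpleGraph V} (H : G.Hex) (i : Fin 3) :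
    H.foot (i.val + 4) = H.fB i := by
  fin_cases i <;> rfl

theorem SimpleGraph.Hex.fA_notMem {G : SimpleGraph V} (H : G.Hex) {k i j : Fin 3}
    (h : H.fA k ∈ (H.seg i j).support) : k = i := by
  by_contra hne
  rcases H.seg_meet i j k j (by simp [Ne.symm hne]) _ h (H.seg k j).start_mem_support with h' | h'
  · exact hne h'.2.symm
  · exact H.disjAB _ _ h'.1

theorem SimpleGraph.Hex.fB_notMem {G : SimpleGraph V} (H : G.Hex) {k i j : Fin 3}
    (h : H.fB k ∈ (H.seg i j).support) : k = j := by
  by_contra hne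
  rcases H.seg_meet i j i k (by simp [Ne.symm hne]) _ h (H.seg i k).end_mem_support with h' | h'
  · exact H.disjAB _ _ h'.1.symm
  · exact hne h'.2.symm

theorem SimpleGraph.Hex.exists_isDrawing {G : SimpleGraph V} (H : G.Hex) :
    ∃ c, G.IsDrawing c H.foot [1, 2, 3, 4, 5, 6] hexEdges := by
  classical
  let r (v : V) (k : ℕ × ℕ) : Prop :=
    (∃ i : Fin 3, v = H.fA i ∧ k = (i.val + 1, i.val + 1)) ∨
      (∃ j : Fin 3, v = H.fB j ∧ k = (j.val + 4, j.val + 4)) ∨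
      ∃ i j : Fin 3, v ∈ (H.seg i j).support ∧ v ≠ H.fA i ∧ v ≠ H.fB j ∧ k = (i.val + 1, j.val + 4)
  have hr : ∀ v k k', r v k → r v k' → k = k' := by
    have hA : ∀ (i k : Fin 3) j, H.fA k ∈ (H.seg i j).support → H.fA k = H.fA i :=
      fun i k j h => congrArg _ (H.fA_notMem h)
    have hB : ∀ (i k : Fin 3) j, H.fB k ∈ (H.seg i j).support → H.fB k = H.fB j :=
      fun i k j h => congrArg _ (H.fB_notMem h)
    rintro v k k' (⟨i, rfl, rfl⟩ | ⟨j, rfl, rfl⟩ | ⟨i, j, hv, hvi, hvj, rfl⟩)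
      (⟨i', hi', rfl⟩ | ⟨j', hj', rfl⟩ | ⟨i', j', hv', hvi', hvj', rfl⟩)
    · rw [H.injA hi']
    · exact absurd hj' (H.disjAB _ _)
    · exact absurd (hA _ _ _ hv') hvi'
    · exact absurd hi'.symm (H.disjAB _ _)
    · rw [H.injB hj']
    · exact absurd (hB _ _ _ hv') hvj'
    · subst hi'
      exact absurd (hA _ _ _ hv) hvi
    · subst hj'
      exact absurd (hB _ _ _ hv) hvj
    · by_contra hne
      rcases H.seg_meet i j i' j' (by rintro h; simp_all) v hv hv' with h | h
      · exact hvi h.1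
      · exact hvj h.1
  have hpos : ∀ v k, r v k → k ≠ (0, 0) := by
    rintro v k (⟨i, -, rfl⟩ | ⟨j, -, rfl⟩ | ⟨i, j, -, -, -, rfl⟩) <;> simp
  let c : V → ℕ × ℕ := fun v => if h : ∃ k, r v k then h.choose else (0, 0)
  have hc : ∀ v k, k ≠ (0, 0) → (c v = k ↔ r v k) := by
    intro v k hk
    by_cases h : ∃ k, r v k
    · simp only [c, h, dite_true]
      exact ⟨fun h' => h' ▸ h.choose_spec, fun h' => hr v _ _ h.choose_spec h'⟩
    · simp only [c, h, dite_false]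
      exact ⟨fun h' => absurd h'.symm hk, fun h' => absurd ⟨k, h'⟩ h⟩
  have hE : ∀ e ∈ hexEdges, ∃ i j : Fin 3, e = (i.val + 1, j.val + 4) := by decide
  have hE' : ∀ i j : Fin 3, (i.val + 1, j.val + 4) ∈ hexEdges := by decide
  have hS : ∀ k ∈ [1, 2, 3, 4, 5, 6], ∃ i : Fin 3, k = i.val + 1 ∨ k = i.val + 4 := by decide
  have hS' : ∀ i : Fin 3, i.val + 1 ∈ [1, 2, 3, 4, 5, 6] ∧ i.val + 4 ∈ [1, 2, 3, 4, 5, 6] := by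
    decide
  refine ⟨c, by decide, ?_, by decide, ?_, ?_⟩
  · intro k hk v
    obtain ⟨i, rfl | rfl⟩ := hS k hk
    · rw [hc v _ (by simp), H.foot_fA]
      refine ⟨?_, fun h => .inl ⟨i, h, rfl⟩⟩
      rintro (⟨i', rfl, h⟩ | ⟨j, -, h⟩ | ⟨i', j, -, -, -, h⟩)
      · rw [Prod.mk.injEq] at h
        exact congrArg _ (Fin.ext (by omega))
      · grind
      · grind
    · rw [hc v _ (by simp), H.foot_fB]
      refine ⟨?_, fun h => .inr (.inl ⟨i, h, rfl⟩)⟩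
      rintro (⟨i', -, h⟩ | ⟨j, rfl, h⟩ | ⟨i', j, -, -, -, h⟩)
      · grind
      · rw [Prod.mk.injEq] at h
        exact congrArg _ (Fin.ext (by omega))
      · grind
  · intro e he
    obtain ⟨i, j, rfl⟩ := hE e he
    simp only [H.foot_fA, H.foot_fB]
    refine ⟨H.seg i j, H.seg_path i j, fun v => ?_⟩
    refine (hc v _ (by simp)).trans ⟨?_, fun h => .inr (.inr ⟨i, j, h.1, h.2.1, h.2.2, rfl⟩)⟩
    rintro (⟨i', -, h⟩ | ⟨j, -, h⟩ | ⟨i', j', h₁, h₂, h₃, h⟩)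
    · grind
    · grind
    · rw [Prod.mk.injEq] at h
      obtain rfl : i = i' := Fin.ext (by omega)
      obtain rfl : j = j' := Fin.ext (by omega)
      exact ⟨h₁, h₂, h₃⟩
  · intro v
    by_cases h : c v = (0, 0)
    · exact .inl h
    · rcases (hc v _ h).1 rfl with ⟨i, -, h⟩ | ⟨i, -, h⟩ | ⟨i, j, -, -, -, h⟩
      · exact .inr (.inl ⟨_, (hS' i).1, h⟩)
      · exact .inr (.inl ⟨_, (hS' i).2, h⟩)
      · exact .inr (.inr (h ▸ hE' i j))

theorem SimpleGraph.IsDrawing.exists_color_ne {G : SimpleGraph V} {c : V → ℕ × ℕ} {P : ℕ → V}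
    {S : List ℕ} {E : List (ℕ × ℕ)} (h : G.IsDrawing c P S E) {e : ℕ × ℕ} (he : e ∈ E)
    (col : G.Coloring Bool) (hcol : col (P e.1) = col (P e.2)) :
    ∃ w, c w = e ∧ col w ≠ col (P e.1) := by
  obtain ⟨he₁, he₂, he₃⟩ := h.edge e he
  have hne : P e.1 ≠ P e.2 := fun h' => he₁.ne (h.injOn he₂ he₃ h')
  obtain ⟨p, -, hp⟩ := h.arc e he
  revert hp hcol hne
  generalize P e.1 = x at p
  generalize P e.2 = y at p
  intro hcol hne hp
  cases p with
  | nil => exact absurd rfl hne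
  | @cons _ w _ hw p =>
    have hcw := (col.valid hw).symm
    exact ⟨w, (hp w).2 ⟨by simp, fun h => hcw (h ▸ rfl), fun h => hcw (h ▸ hcol.symm)⟩, hcw⟩

/-- Hexes in the graphs obtained from `K_{3,3}` by adding a path from an edge to another vertex
or edge. -/
def shiftModels : List HexModel := [
  ⟨![1, 2, 3], ![5, 6, 8], ![![[5], [6], [8]], ![[5], [6], [8]], ![[5], [6], [4, 8]]]⟩,
  ⟨![1, 2, 3], ![5, 6, 8], ![![[5], [6], [8]], ![[5], [6], [4, 8]], ![[5], [6], [8]]]⟩,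
  ⟨![2, 3, 8], ![4, 5, 6], ![![[4], [5], [6]], ![[4], [5], [6]], ![[4], [5], [1, 6]]]⟩,
  ⟨![2, 3, 8], ![4, 5, 6], ![![[4], [5], [6]], ![[4], [5], [6]], ![[4], [1, 5], [6]]]⟩,
  ⟨![2, 3, 8], ![4, 5, 6], ![![[4], [5], [6]], ![[4], [5], [6]], ![[4], [7, 5], [1, 6]]]⟩,
  ⟨![2, 3, 8], ![4, 5, 6], ![![[4], [5], [6]], ![[4], [5], [6]], ![[4], [1, 5], [7, 6]]]⟩,
  ⟨![1, 2, 3], ![5, 6, 8], ![![[5], [6], [8]], ![[5], [6], [7, 8]], ![[5], [6], [4, 8]]]⟩,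
  ⟨![2, 3, 8], ![4, 6, 7], ![![[4], [6], [7]], ![[4], [6], [5, 7]], ![[4], [1, 6], [7]]]⟩,
  ⟨![2, 3, 8], ![4, 5, 7], ![![[4], [5], [7]], ![[4], [5], [6, 7]], ![[4], [1, 5], [7]]]⟩,
  ⟨![1, 3, 7], ![5, 6, 8], ![![[5], [6], [8]], ![[5], [6], [4, 8]], ![[2, 5], [6], [8]]]⟩,
  ⟨![1, 2, 3], ![5, 6, 8], ![![[5], [6], [8]], ![[5], [6], [4, 8]], ![[5], [6], [7, 8]]]⟩,
  ⟨![2, 3, 8], ![4, 6, 7], ![![[4], [6], [5, 7]], ![[4], [6], [7]], ![[4], [1, 6], [7]]]⟩,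
  ⟨![1, 4, 7], ![3, 5, 8], ![![[6, 3], [5], [8]], ![[3], [2, 5], [8]], ![[3], [5], [8]]]⟩,
  ⟨![1, 4, 7], ![3, 6, 8], ![![[5, 3], [6], [8]], ![[3], [2, 6], [8]], ![[3], [6], [8]]]⟩]

/-- Hexes in the graphs obtained from the Wagner graph by adding a path from a spoke to another
vertex or edge. -/
def wagnerModels : List HexModel := [
  ⟨![1, 2, 5], ![6, 7, 10], ![![[6], [8, 7], [10]], ![[6], [7], [10]], ![[3, 6], [7], [10]]]⟩,
  ⟨![1, 4, 7], ![2, 3, 8], ![![[6, 2], [10, 3], [8]], ![[2], [3], [8]], ![[2], [5, 3], [8]]]⟩,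
  ⟨![2, 3, 10], ![4, 5, 6], ![![[4], [7, 5], [6]], ![[4], [5], [6]], ![[4], [5], [1, 6]]]⟩,
  ⟨![2, 5, 8], ![4, 6, 7], ![![[4], [6], [7]], ![[3, 4], [10, 6], [7]], ![[4], [1, 6], [7]]]⟩,
  ⟨![1, 2, 3], ![4, 6, 7], ![![[8, 4], [6], [10, 7]], ![[4], [6], [7]], ![[4], [6], [5, 7]]]⟩,
  ⟨![2, 3, 8], ![4, 5, 6], ![![[4], [7, 5], [6]], ![[4], [5], [6]], ![[4], [10, 5], [1, 6]]]⟩,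
  ⟨![2, 3, 10], ![4, 5, 6], ![![[4], [7, 5], [6]], ![[4], [5], [6]], ![[9, 8, 4], [5], [1, 6]]]⟩,
  ⟨![2, 3, 10], ![4, 5, 6], ![![[4], [7, 5], [6]], ![[4], [5], [6]], ![[9, 4], [5], [1, 6]]]⟩,
  ⟨![2, 3, 8], ![4, 5, 6], ![![[4], [7, 5], [6]], ![[4], [5], [6]], ![[4], [9, 10, 5], [1, 6]]]⟩,
  ⟨![1, 2, 3], ![4, 6, 10], ![![[8, 4], [6], [10]], ![[4], [6], [9, 10]], ![[4], [6], [5, 10]]]⟩,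
  ⟨![1, 2, 3], ![4, 6, 10], ![![[8, 4], [6], [10]], ![[4], [6], [7, 9, 10]], ![[4], [6], [5, 10]]]⟩,
  ⟨![2, 3, 10], ![4, 5, 6], ![![[4], [7, 5], [6]], ![[4], [5], [6]], ![[1, 8, 4], [5], [9, 6]]]⟩,
  ⟨![2, 4, 5], ![3, 7, 9], ![![[6, 3], [7], [9]], ![[3], [8, 7], [9]], ![[3], [7], [10, 9]]]⟩,
  ⟨![2, 5, 8], ![4, 7, 10], ![![[4], [7], [9, 10]], ![[3, 4], [7], [10]], ![[4], [7], [1, 10]]]⟩,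
  ⟨![1, 4, 7], ![2, 8, 10], ![![[6, 2], [8], [10]], ![[2], [8], [9, 10]], ![[2], [8], [5, 10]]]⟩,
  ⟨![1, 2, 3], ![4, 6, 10], ![![[8, 4], [6], [10]], ![[4], [6], [7, 5, 10]], ![[4], [6], [9, 10]]]⟩,
  ⟨![2, 5, 8], ![4, 6, 7], ![![[4], [6], [7]], ![[3, 4], [10, 9, 6], [7]], ![[4], [1, 6], [7]]]⟩]

/-- The colours of the drawn vertices: the feet `3` and `6` of the original hex have colours `p` and
`q`, the other feet are white, the vertices `8` and `10` are black, and `7` and `9` are ends of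
added paths. -/
def drawnColor (p q r s : Bool) (i : ℕ) : Bool :=
  [false, false, false, p, false, false, q, r, true, s, true].getD i false

/-- The number of odd segments of the original hex. -/
def initialOdd (p q : Bool) : ℕ := oddPairs ![false, false, p] ![false, false, q]

/-- Some hex in the graph with vertex set `S` and edge set `E` has more than `n` odd segments. -/
def Improves (models : List HexModel) (S : List ℕ) (E : List (ℕ × ℕ)) (Q : ℕ → Bool) (n : ℕ) :
    Prop :=
  ∃ M ∈ models, M.IsValid S E ∧ n < oddPairs (fun i => Q (M.A i)) (fun j => Q (M.B j))

instance (models : List HexModel) (S : List ℕ) (E : List (ℕ × ℕ)) (Q : ℕ → Bool) (n : ℕ) :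
    Decidable (Improves models S E Q n) :=
  inferInstanceAs (Decidable (∃ M ∈ models, _))

theorem improves_of_vertex (p q : Bool) : ∀ k ∈ [1, 2, 3, 4, 5, 6], k ≠ 1 → k ≠ 4 →
    Improves shiftModels [8, 1, 2, 3, 4, 5, 6]
      ((1, 8) :: (4, 8) :: (k, 8) :: hexEdges.filter (· ≠ (1, 4)))
      (drawnColor p q false false) (initialOdd p q) := by
  revert p q
  decide +kernel

theorem improves_of_edge (p q r : Bool) : ∀ f ∈ hexEdges, f ≠ (1, 4) →
    Improves shiftModels [8, 7, 1, 2, 3, 4, 5, 6]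
      ((1, 8) :: (4, 8) :: (7, 8) :: (f.1, 7) :: (f.2, 7) ::
        (hexEdges.filter (· ≠ (1, 4))).filter (· ≠ f))
      (drawnColor p q r false) (initialOdd p q) ∨
    f = (2, 5) ∧ p = true ∧ q = true ∧ r = true := by
  revert p q r
  decide +kernel

/-- The edges of the Wagner graph, obtained from `K_{3,3}` by adding a path between two disjoint
edges. -/
def wagnerEdges : List (ℕ × ℕ) :=
  (1, 8) :: (4, 8) :: (7, 8) :: (2, 7) :: (5, 7) ::
    (hexEdges.filter (· ≠ (1, 4))).filter (· ≠ (2, 5))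

theorem improves_wagner_of_vertex : ∀ k ∈ [8, 7, 1, 2, 3, 4, 5, 6], k ≠ 1 → k ≠ 5 →
    Improves wagnerModels [10, 8, 7, 1, 2, 3, 4, 5, 6]
      ((1, 10) :: (5, 10) :: (k, 10) :: wagnerEdges.filter (· ≠ (1, 5)))
      (drawnColor true true true false) (initialOdd true true) := by
  decide +kernel

theorem improves_wagner_of_edge (s : Bool) : ∀ f ∈ wagnerEdges, f ≠ (1, 5) →
    Improves wagnerModels [10, 9, 8, 7, 1, 2, 3, 4, 5, 6]
      ((1, 10) :: (5, 10) :: (9, 10) :: (f.1, 9) :: (f.2, 9) ::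
        (wagnerEdges.filter (· ≠ (1, 5))).filter (· ≠ f))
      (drawnColor true true true s) (initialOdd true true) := by
  revert s
  decide +kernel

theorem SimpleGraph.IsDrawing.exists_hex_lt {G : SimpleGraph V} {c : V → ℕ × ℕ} {P : ℕ → V}
    {S : List ℕ} {E : List (ℕ × ℕ)} (h : G.IsDrawing c P S E) (col : G.Coloring Bool)
    {Q : ℕ → Bool} {models : List HexModel} {n : ℕ} (hM : Improves models S E Q n)
    (hQ : ∀ i ∈ S, col (P i) = Q i) : ∃ H : G.Hex, n < H.oddCount := by
  obtain ⟨M, -, hM, hn⟩ := hM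
  obtain ⟨H, hH⟩ := h.exists_hex hM col hQ
  exact ⟨H, hH ▸ hn⟩

/-- A hex with four white feet, two on either side, is not optimal. -/
theorem SimpleGraph.ThreeConnected.exists_hex_lt [Fintype V] {G : SimpleGraph V}
    (hG : G.ThreeConnected) (col : G.Coloring Bool) (H : G.Hex) (hA₀ : col (H.fA 0) = false)
    (hA₁ : col (H.fA 1) = false) (hB₀ : col (H.fB 0) = false) (hB₁ : col (H.fB 1) = false) :
    ∃ H' : G.Hex, initialOdd (col (H.fA 2)) (col (H.fB 2)) < H'.oddCount := by
  classical
  obtain ⟨c, D⟩ := H.exists_isDrawing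
  obtain ⟨w, hw, hcol⟩ := D.exists_color_ne (e := (1, 4)) (by decide) col (hA₀.trans hB₀.symm)
  have hcw : col w = true := by simpa [Hex.foot, hA₀] using hcol
  rcases D.exists_fan hG (by decide) hw (by decide) (n := 7) (m := 8) (by decide) (by decide) with
    ⟨k, hk, hk₁, hk₂, c', D'⟩ | ⟨f, hf, hfe, y, c', D'⟩
  · refine D'.exists_hex_lt col (improves_of_vertex _ _ k hk hk₁ hk₂) ?_
    simp [drawnColor, Hex.foot, Function.update, hA₀, hA₁, hB₀, hB₁, hcw]
  rcases improves_of_edge (col (H.fA 2)) (col (H.fB 2)) (col y) f hf hfe with h | ⟨rfl, hp, hq, hr⟩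
  · refine D'.exists_hex_lt col h ?_
    simp [drawnColor, Hex.foot, Function.update, hA₀, hA₁, hB₀, hB₁, hcw]
  rw [hp, hq]
  obtain ⟨u, hu, hcol⟩ := D'.exists_color_ne (e := (1, 5)) (by decide) col
    (by simp [Hex.foot, Function.update, hA₀, hB₁])
  have hcu : col u = true := by simpa [Hex.foot, Function.update, hA₀] using hcol
  rcases D'.exists_fan hG (by decide) hu (by decide) (n := 9) (m := 10) (by decide) (by decide) with
    ⟨k, hk, hk₁, hk₂, c'', D''⟩ | ⟨f, hf, hfe, z, c'', D''⟩
  · refine D''.exists_hex_lt col (improves_wagner_of_vertex k hk hk₁ hk₂) ?_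
    simp [drawnColor, Hex.foot, Function.update, hA₀, hA₁, hB₀, hB₁, hcw, hcu, hp, hq, hr]
  · refine D''.exists_hex_lt col (improves_wagner_of_edge (col z) f hf hfe) ?_
    simp [drawnColor, Hex.foot, Function.update, hA₀, hA₁, hB₀, hB₁, hcw, hcu, hp, hq, hr]

/-- Renumbering the feet of a hex. -/
def SimpleGraph.Hex.reindex {G : SimpleGraph V} (H : G.Hex) (σ τ : Equiv.Perm (Fin 3)) : G.Hex where
  fA i := H.fA (σ i)
  fB j := H.fB (τ j)
  injA := H.injA.comp σ.injective
  injB := H.injB.comp τ.injective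
  disjAB i j := H.disjAB (σ i) (τ j)
  seg i j := H.seg (σ i) (τ j)
  seg_path i j := H.seg_path (σ i) (τ j)
  seg_meet i j i' j' h x hx hx' := by
    simpa using H.seg_meet (σ i) (τ j) (σ i') (τ j') (by simpa using h) x hx hx'

theorem exists_perm_of_oddPairs_lt : ∀ α β : Fin 3 → Bool, oddPairs α β < 5 →
    ∃ (σ τ : Equiv.Perm (Fin 3)) (s : Bool), α (σ 0) = s ∧ α (σ 1) = s ∧ β (τ 0) = s ∧ β (τ 1) = s ∧
      oddPairs α β = initialOdd (xor s (α (σ 2))) (xor s (β (τ 2))) := by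
  decide +kernel

/-- In an internally 4-connected bipartite graph, every optimal hex has at least five odd
segments. -/
theorem stmt_9 {V : Type u} [Fintype V] (G : SimpleGraph V) (A B : Set V)
    (hbip : G.IsBipartition A B) (h4 : G.InternallyFourConnected)
    (H : G.Hex) (hopt : H.Optimal) :
    5 ≤ H.oddCount := by
  classical
  by_contra! hlt
  obtain ⟨hdisj, -, hadj⟩ := hbip
  have hcol : ∀ s : Bool, ∀ {x y : V}, G.Adj x y →
      xor s (decide (x ∈ A)) ≠ xor s (decide (y ∈ A)) := by
    intro s x y hxy
    rcases hadj hxy with ⟨hx, hy⟩ | ⟨hx, hy⟩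
    · have : y ∉ A := fun h => Set.disjoint_left.1 hdisj h hy
      simp [*]
    · have : x ∉ A := fun h => Set.disjoint_left.1 hdisj h hx
      simp [*]
  let col (s : Bool) : G.Coloring Bool := .mk (fun v => xor s (decide (v ∈ A))) (hcol s)
  have hH := H.oddCount_eq (col false)
  obtain ⟨σ, τ, s, h₀, h₁, h₂, h₃, h⟩ := exists_perm_of_oddPairs_lt _ _ (hH ▸ hlt)
  have hflip : ∀ v, col s v = xor s (col false v) := fun v => by
    change xor s _ = xor s (xor false _)
    rw [Bool.false_xor]
  obtain ⟨H', hH'⟩ := h4.1.exists_hex_lt (col s) (H.reindex σ τ)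
    (by simp [hflip, Hex.reindex, h₀]) (by simp [hflip, Hex.reindex, h₁])
    (by simp [hflip, Hex.reindex, h₂]) (by simp [hflip, Hex.reindex, h₃])
  have := hopt H'
  simp only [hflip, Hex.reindex] at hH'
  omega
end

section
/- Let G be an internally 4-connected bipartite graph. Then every optimal hex of G has at least six odd segments. -/
open SimpleGraph

universe u

variable {V : Type u}

namespace SimpleGraph

/-- `S` is the vertex set of a path of `G` from `x` to `y`. -/
def IsPathSet (G : SimpleGraph V) (x y : V) (S : Set V) : Prop :=
  ∃ p : G.Walk x y, p.IsPath ∧ ∀ z, z ∈ S ↔ z ∈ p.support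

namespace IsPathSet

variable {G : SimpleGraph V} {x y z : V} {S T : Set V}

theorem left_mem (h : G.IsPathSet x y S) : x ∈ S := by
  obtain ⟨p, -, h⟩ := h
  simp [h]

theorem right_mem (h : G.IsPathSet x y S) : y ∈ S := by
  obtain ⟨p, -, h⟩ := h
  simp [h]

theorem symm (h : G.IsPathSet x y S) : G.IsPathSet y x S := by
  obtain ⟨p, hp, h⟩ := h
  exact ⟨p.reverse, hp.reverse, by simpa using h⟩

theorem trans (hS : G.IsPathSet x y S) (hT : G.IsPathSet y z T) (h : S ∩ T ⊆ {y}) :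
    G.IsPathSet x z (S ∪ T) := by
  obtain ⟨p, hp, hS⟩ := hS
  obtain ⟨q, hq, hT⟩ := hT
  refine ⟨p.append q, ?_, fun t => by simp [hS, hT, Walk.mem_support_append_iff]⟩
  rw [Walk.isPath_def, Walk.support_append, List.nodup_append']
  refine ⟨hp.support_nodup, hq.support_nodup.tail, fun t ht ht' => ?_⟩
  have hty : t = y := h ⟨(hS t).2 ht, (hT t).2 (List.mem_of_mem_tail ht')⟩
  have hnd := hq.support_nodup
  rw [← q.cons_tail_support, List.nodup_cons] at hnd
  exact hnd.1 (hty ▸ ht')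

theorem split (h : G.IsPathSet x y S) (hz : z ∈ S) :
    ∃ S₁ S₂, G.IsPathSet x z S₁ ∧ G.IsPathSet z y S₂ ∧ S₁ ∪ S₂ = S ∧ S₁ ∩ S₂ ⊆ {z} := by
  obtain ⟨p, hp, h⟩ := h
  obtain ⟨q, r, hq, hr, rfl⟩ := hp.mem_support_iff_exists_append.1 ((h z).1 hz)
  refine ⟨{t | t ∈ q.support}, {t | t ∈ r.support}, ⟨q, hq, fun _ => Iff.rfl⟩,
    ⟨r, hr, fun _ => Iff.rfl⟩, ?_, ?_⟩
  · ext t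
    simp [h, Walk.mem_support_append_iff]
  · rintro t ⟨ht, ht'⟩
    by_contra hne
    have hnd := hp.support_nodup
    rw [Walk.support_append, List.nodup_append'] at hnd
    refine hnd.2.2 ht ?_
    have ht'' : t ∈ r.support := ht'
    rw [← r.cons_tail_support, List.mem_cons] at ht''
    exact ht''.resolve_left hne

theorem exists_adj (h : G.IsPathSet x y S) (hxy : x ≠ y) : ∃ w ∈ S, G.Adj x w := by
  obtain ⟨p, -, h⟩ := h
  cases p with
  | nil => exact absurd rfl hxy
  | cons hadj q => exact ⟨_, by simp [h], hadj⟩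

theorem of_connected_induce {Z : Set V} (hconn : (G.induce Zᶜ).Connected) (hx : x ∉ Z)
    (hy : y ∉ Z) : ∃ S, G.IsPathSet x y S ∧ Disjoint S Z := by
  obtain ⟨p, hp⟩ := hconn.exists_isPath ⟨x, hx⟩ ⟨y, hy⟩
  let q := p.map (Embedding.induce Zᶜ).toHom
  have hq : q.IsPath := hp.map Subtype.val_injective
  refine ⟨{t | t ∈ q.support}, ⟨q, hq, fun _ => Iff.rfl⟩, Set.disjoint_left.2 fun t ht => ?_⟩
  have ht' : t ∈ q.support := ht
  rw [Walk.support_map, List.mem_map] at ht'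
  obtain ⟨s, -, rfl⟩ := ht'
  exact s.2

/-- A path between two sets avoiding `Z` can be shortened so that only its ends lie in them. -/
theorem exists_minimal [Finite V] {X Y Z : Set V} (hx : x ∈ X) (hy : y ∈ Y)
    (hS : G.IsPathSet x y S) (hZ : Disjoint S Z) :
    ∃ x ∈ X, ∃ y ∈ Y, ∃ S, G.IsPathSet x y S ∧ Disjoint S Z ∧ S ∩ X ⊆ {x} ∧ S ∩ Y ⊆ {y} := by
  induction hn : S.ncard using Nat.strong_induction_on generalizing x y S with
  | _ n ih =>
  subst hn
  by_cases hX : S ∩ X ⊆ {x}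
  · by_cases hY : S ∩ Y ⊆ {y}
    · exact ⟨x, hx, y, hy, S, hS, hZ, hX, hY⟩
    · obtain ⟨z, ⟨hz, hzY⟩, hne⟩ := Set.not_subset.1 hY
      obtain ⟨S₁, S₂, h₁, h₂, rfl, hI⟩ := hS.split hz
      refine ih _ (Set.ncard_lt_ncard ⟨Set.subset_union_left, fun hsub => ?_⟩) hx hzY h₁
        (hZ.mono_left Set.subset_union_left) rfl
      exact hne (hI ⟨hsub (Or.inr h₂.right_mem), h₂.right_mem⟩).symm
  · obtain ⟨z, ⟨hz, hzX⟩, hne⟩ := Set.not_subset.1 hX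
    obtain ⟨S₁, S₂, h₁, h₂, rfl, hI⟩ := hS.split hz
    refine ih _ (Set.ncard_lt_ncard ⟨Set.subset_union_right, fun hsub => ?_⟩) hzX hy h₂
      (hZ.mono_left Set.subset_union_right) rfl
    exact hne (hI ⟨h₁.left_mem, hsub (Or.inl h₁.left_mem)⟩).symm

end IsPathSet

/-- `P`, `Q` are the vertex sets of a fan of two paths from `w` to `a`, `b` in the set `Y`. -/
structure IsFan (G : SimpleGraph V) (Y : Set V) (w a b : V) (P Q : Set V) : Prop where
  left : G.IsPathSet w a P
  right : G.IsPathSet w b Q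
  inter : P ∩ Q ⊆ {w}
  left_inter : P ∩ Y ⊆ {a}
  right_inter : Q ∩ Y ⊆ {b}

theorem IsFan.symm {G : SimpleGraph V} {Y : Set V} {w a b : V} {P Q : Set V}
    (h : G.IsFan Y w a b P Q) : G.IsFan Y w b a Q P :=
  ⟨h.right, h.left, Set.inter_comm P Q ▸ h.inter, h.right_inter, h.left_inter⟩

/-- There is a fan of three paths from `w` to `Y`, two of which end in `a` and `b`. -/
def HasThreeFan (G : SimpleGraph V) (Y : Set V) (w a b : V) : Prop :=
  ∃ s ∈ Y, s ≠ a ∧ s ≠ b ∧ ∃ P Q R, G.IsFan Y w a b P Q ∧ G.IsPathSet w s R ∧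
    R ∩ Y ⊆ {s} ∧ R ∩ P ⊆ {w} ∧ R ∩ Q ⊆ {w}

theorem HasThreeFan.symm {G : SimpleGraph V} {Y : Set V} {w a b : V}
    (h : G.HasThreeFan Y w a b) : G.HasThreeFan Y w b a := by
  obtain ⟨s, hs, hsa, hsb, P, Q, R, hF, hR, hY, hP, hQ⟩ := h
  exact ⟨s, hs, hsb, hsa, Q, P, R, hF.symm, hR, hY, hQ, hP⟩

/-- The augmentation step: `R` leads from a vertex `x` of `P` to the vertex `y` of `Y`, and `Y'`
is `Y` together with `R` and the part `P₂` of `P` after `x`. -/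
theorem HasThreeFan.of_augment {G : SimpleGraph V} {Y P₁ P₂ Q R : Set V} {w a b x y : V}
    (hb : b ∈ Y) (hab : a ≠ b) (hF : G.IsFan Y w a b (P₁ ∪ P₂) Q)
    (hP₂ : G.IsPathSet x a P₂) (hy : y ∈ Y)
    (hR : G.IsPathSet x y R) (hRa : a ∉ R) (hRb : b ∉ R) (hRP : R ∩ (P₁ ∪ P₂) ⊆ {x})
    (hRY : R ∩ Y ⊆ {y}) (h : G.HasThreeFan (Y ∪ P₂ ∪ R) w x b) : G.HasThreeFan Y w a b := by
  obtain ⟨s, hs, hsx, hsb, P', Q', R', hF', hR', hRY', hRP', hRQ'⟩ := h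
  have hxY : x ∉ Y := fun hx =>
    hRa ((hF.left_inter ⟨Or.inr hP₂.left_mem, hx⟩ : x = a) ▸ hR.left_mem)
  have hPY := hF.left_inter
  have hP'i := hF'.left_inter
  have hQ'i := hF'.right_inter
  have hPQ := hF'.inter
  simp only [Set.subset_def, Set.mem_inter_iff, Set.mem_union, Set.mem_singleton_iff] at *
  have hP₂a := hP₂.right_mem
  have hRx := hR.left_mem
  have hRy := hR.right_mem
  have hQ'b := hF'.right.right_mem
  by_cases hsP : s ∈ P₂
  · obtain ⟨T₁, T₂, hT₁, hT₂, rfl, hT⟩ := hP₂.split hsP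
    simp only [Set.subset_def, Set.mem_inter_iff, Set.mem_union, Set.mem_singleton_iff] at *
    have hxT : x ∉ T₂ := fun hx => hsx (hT x ⟨hT₁.left_mem, hx⟩).symm
    refine ⟨y, hy, ?_, ?_, R' ∪ T₂, Q', P' ∪ R, ⟨hR'.trans hT₂ ?_, hF'.right, ?_, ?_, ?_⟩,
      hF'.left.trans hR ?_, ?_, ?_, ?_⟩
    all_goals
      try simp only [Set.subset_def, Set.mem_inter_iff, Set.mem_union, Set.mem_singleton_iff]
      grind
  · by_cases hsR : s ∈ R
    · obtain ⟨T₁, T₂, hT₁, hT₂, rfl, hT⟩ := hR.split hsR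
      simp only [Set.subset_def, Set.mem_inter_iff, Set.mem_union, Set.mem_singleton_iff] at *
      have hxT : x ∉ T₂ := fun hx => hsx (hT x ⟨hT₁.left_mem, hx⟩).symm
      refine ⟨y, hy, ?_, ?_, P' ∪ P₂, Q', R' ∪ T₂, ⟨hF'.left.trans hP₂ ?_, hF'.right, ?_, ?_, ?_⟩,
        hR'.trans hT₂ ?_, ?_, ?_, ?_⟩
      all_goals
        try simp only [Set.subset_def, Set.mem_inter_iff, Set.mem_union, Set.mem_singleton_iff]
        grind
    · refine ⟨s, ?_, ?_, ?_, P' ∪ P₂, Q', R', ⟨hF'.left.trans hP₂ ?_, hF'.right, ?_, ?_, ?_⟩,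
        hR', ?_, ?_, ?_⟩
      all_goals
        try simp only [Set.subset_def, Set.mem_inter_iff, Set.mem_union, Set.mem_singleton_iff]
        grind

/-- In a 3-connected graph a fan of two paths to `Y` extends to a fan of three paths that keeps
the old ends. -/
theorem IsFan.hasThreeFan [Finite V] {G : SimpleGraph V}
    (hconn : ∀ a b : V, (G.induce ({a, b} : Set V)ᶜ).Connected) {Y P Q : Set V} {w a b y : V}
    (hw : w ∉ Y) (ha : a ∈ Y) (hb : b ∈ Y) (hab : a ≠ b) (hy : y ∈ Y) (hya : y ≠ a)
    (hyb : y ≠ b) (hF : G.IsFan Y w a b P Q) : G.HasThreeFan Y w a b := by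
  induction hn : Yᶜ.ncard using Nat.strong_induction_on generalizing Y P Q a b y with
  | _ n ih =>
  subst hn
  have key : ∀ {a b y x : V} {P Q R : Set V}, a ∈ Y → b ∈ Y → a ≠ b → G.IsFan Y w a b P Q →
      x ∈ P → x ≠ w → y ∈ Y → G.IsPathSet x y R → a ∉ R → b ∉ R → R ∩ (P ∪ Q) ⊆ {x} →
      R ∩ Y ⊆ {y} → G.HasThreeFan Y w a b := by
    intro a b y x P Q R ha hb hab hF hx hxw hy hR hRa hRb hRP hRY
    obtain ⟨P₁, P₂, hP₁, hP₂, rfl, hP⟩ := hF.left.split hx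
    have hxY : x ∉ Y := fun hx' => hRa ((hF.left_inter ⟨hx, hx'⟩ : x = a) ▸ hR.left_mem)
    have hPQ := hF.inter
    have hPY := hF.left_inter
    have hQY := hF.right_inter
    have hwP := hP₁.left_mem
    have hP₂a := hP₂.right_mem
    have hP₂x := hP₂.left_mem
    have hP₁x := hP₁.right_mem
    refine HasThreeFan.of_augment hb hab hF hP₂ hy hR hRa hRb ?_ hRY
      (ih (Y ∪ P₂ ∪ R)ᶜ.ncard (Set.ncard_lt_ncard ?_) (P := P₁) (Q := Q) (y := a)
        ?_ ?_ ?_ ?_ ?_ ?_ hab ⟨hP₁, hF.right, ?_, ?_, ?_⟩ rfl)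
    · exact (Set.inter_subset_inter_right _ Set.subset_union_left).trans hRP
    · refine ⟨Set.compl_subset_compl.2 fun t ht => Or.inl (Or.inl ht), fun hsub => ?_⟩
      exact hsub hxY (Or.inl (Or.inr hP₂x))
    all_goals
      simp only [Set.subset_def, Set.mem_inter_iff, Set.mem_union, Set.mem_singleton_iff] at *
      grind
  have hwa : w ≠ a := fun h => hw (h ▸ ha)
  have hwb : w ≠ b := fun h => hw (h ▸ hb)
  obtain ⟨S, hS, hSd⟩ := IsPathSet.of_connected_induce (x := w) (y := y) (hconn a b)
    (by simp [hwa, hwb]) (by simp [hya, hyb])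
  obtain ⟨x, hx, y, hy, R, hR, hRd, hRP, hRY⟩ :=
    IsPathSet.exists_minimal (X := P ∪ Q) (Or.inl hF.left.left_mem) hy hS hSd
  have hRa : a ∉ R := fun h => Set.disjoint_left.1 hRd h (by simp)
  have hRb : b ∉ R := fun h => Set.disjoint_left.1 hRd h (by simp)
  by_cases hxw : x = w
  · subst hxw
    refine ⟨y, hy, fun h => hRa (h ▸ hR.right_mem), fun h => hRb (h ▸ hR.right_mem), P, Q, R, hF,
      hR, hRY, (Set.inter_subset_inter_right _ Set.subset_union_left).trans hRP,
      (Set.inter_subset_inter_right _ Set.subset_union_right).trans hRP⟩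
  · rcases hx with hx | hx
    · exact key ha hb hab hF hx hxw hy hR hRa hRb hRP hRY
    · exact (key hb ha hab.symm hF.symm hx hxw hy hR hRb hRa (Set.union_comm P Q ▸ hRP) hRY).symm

/-- A graph on an initial segment of `ℕ` with coloured vertices. -/
structure Pattern where
  size : ℕ
  color : ℕ → Bool
  edges : List (ℕ × ℕ)

/-- The vertex `i` is an end of the edge `e`. -/
abbrev Pattern.Inc (i : ℕ) (e : ℕ × ℕ) : Prop := i = e.1 ∨ i = e.2

/-- The branch vertices `f` and vertex sets of paths `S` form a subdivision of `P` in `G`. Only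
the branch vertices that are ends of edges of `P` matter. -/
structure Pattern.IsModel (P : Pattern) (G : SimpleGraph V) (κ : V → Bool) (f : ℕ → V)
    (S : ℕ × ℕ → Set V) : Prop where
  lt : ∀ e ∈ P.edges, ∀ i, Pattern.Inc i e → i < P.size
  ne : ∀ e ∈ P.edges, e.1 ≠ e.2
  inj : ∀ e ∈ P.edges, ∀ e' ∈ P.edges, ∀ i j, Pattern.Inc i e → Pattern.Inc j e' →
    f i = f j → i = j
  color_eq : ∀ e ∈ P.edges, ∀ i, Pattern.Inc i e → κ (f i) = P.color i
  path : ∀ e ∈ P.edges, G.IsPathSet (f e.1) (f e.2) (S e)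
  meet : ∀ e ∈ P.edges, ∀ e' ∈ P.edges, e ≠ e' → ∀ x ∈ S e, x ∈ S e' →
    ∃ i, x = f i ∧ Pattern.Inc i e ∧ Pattern.Inc i e'

/-- `G` contains a subdivision of `P` with the prescribed colours. -/
def Pattern.Occurs (P : Pattern) (G : SimpleGraph V) (κ : V → Bool) : Prop :=
  ∃ f S, P.IsModel G κ f S

namespace Pattern

variable {G : SimpleGraph V} {κ : V → Bool} {P : Pattern} {f : ℕ → V} {S : ℕ × ℕ → Set V}

theorem IsModel.mem_of_inc (h : P.IsModel G κ f S) {e : ℕ × ℕ} (he : e ∈ P.edges) {i : ℕ}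
    (hi : Inc i e) : f i ∈ S e := by
  rcases hi with rfl | rfl
  exacts [(h.path e he).left_mem, (h.path e he).right_mem]

/-- A branch vertex on a path is an end of it. -/
theorem IsModel.inc_of_mem (h : P.IsModel G κ f S) {e e' : ℕ × ℕ} (he : e ∈ P.edges)
    (he' : e' ∈ P.edges) {i : ℕ} (hi : Inc i e) (hm : f i ∈ S e') : Inc i e' := by
  by_cases hee : e = e'
  · exact hee ▸ hi
  · obtain ⟨j, hj, hje, hje'⟩ := h.meet e he e' he' hee _ (h.mem_of_inc he hi) hm
    exact h.inj e he e he i j hi hje hj ▸ hje'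

theorem Occurs.mono {E : List (ℕ × ℕ)} (h : P.Occurs G κ) (hE : E ⊆ P.edges) :
    Pattern.Occurs ⟨P.size, P.color, E⟩ G κ := by
  obtain ⟨f, S, h⟩ := h
  exact ⟨f, S, fun e he => h.lt e (hE he), fun e he => h.ne e (hE he),
    fun e he e' he' => h.inj e (hE he) e' (hE he'), fun e he => h.color_eq e (hE he),
    fun e he => h.path e (hE he), fun e he e' he' => h.meet e (hE he) e' (hE he')⟩

/-- Incidence as a Boolean. -/
def incB (i : ℕ) (e : ℕ × ℕ) : Bool := Nat.beq i e.1 || Nat.beq i e.2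

theorem incB_iff {i : ℕ} {e : ℕ × ℕ} : incB i e = true ↔ Inc i e := by
  simp [incB]

/-- The end of `e` other than `v`. -/
def other (v : ℕ) (e : ℕ × ℕ) : ℕ := bif Nat.beq v e.1 then e.2 else e.1

theorem other_spec {v : ℕ} {e : ℕ × ℕ} (h : Inc v e) :
    v = e.1 ∧ other v e = e.2 ∨ v = e.2 ∧ other v e = e.1 := by
  rw [other, Bool.cond_eq_ite]
  split_ifs with hv
  · exact Or.inl ⟨Nat.eq_of_beq_eq_true hv, rfl⟩
  · exact Or.inr ⟨h.resolve_left fun h => hv (by simp [h]), rfl⟩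

/-! The following functions are evaluated by the kernel. For speed they are written with recursors,
and they pass their results, fully evaluated, to a continuation. -/

/-- Pass the edges selected by the bits of `m` to `k`. -/
noncomputable def select (m : ℕ) (E : List (ℕ × ℕ)) (k : List (ℕ × ℕ) → Bool) : Bool :=
  List.rec (motive := fun _ => ℕ → (List (ℕ × ℕ) → Bool) → Bool) (fun _ k => k [])
    (fun e _ r m k => Bool.rec (r (Nat.div m 2) k) (r (Nat.div m 2) fun R => k (e :: R))
      (Nat.beq (Nat.mod m 2) 1)) E m k

theorem exists_of_select {E : List (ℕ × ℕ)} : ∀ {m : ℕ} {k : List (ℕ × ℕ) → Bool},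
    select m E k = true → ∃ R ⊆ E, k R = true := by
  induction E with
  | nil => exact fun h => ⟨[], List.Subset.refl _, h⟩
  | cons e E ih =>
    intro m k h
    change (Bool.rec (select (Nat.div m 2) E k) (select (Nat.div m 2) E fun R => k (e :: R))
      (Nat.beq (Nat.mod m 2) 1) : Bool) = true at h
    cases hm : Nat.beq (Nat.mod m 2) 1 <;> rw [hm] at h <;> obtain ⟨R, hR, hk⟩ := ih h
    · exact ⟨R, List.subset_cons_of_subset _ hR, hk⟩
    · exact ⟨e :: R, List.cons_subset_cons _ hR, hk⟩

/-- Pass the neighbours of `v` and the edges that do not end in `v` to `k`. -/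
noncomputable def extract (v : ℕ) (E : List (ℕ × ℕ)) (k : List ℕ → List (ℕ × ℕ) → Bool) : Bool :=
  List.rec (motive := fun _ => (List ℕ → List (ℕ × ℕ) → Bool) → Bool) (fun k => k [] [])
    (fun e _ r k =>
      Bool.rec
        (Bool.rec (r fun N R => k N (e :: R)) (r fun N R => k (e.1 :: N) R) (Nat.beq v e.2))
        (r fun N R => k (e.2 :: N) R) (Nat.beq v e.1)) E k

theorem extract_eq (v : ℕ) (E : List (ℕ × ℕ)) (k : List ℕ → List (ℕ × ℕ) → Bool) :
    extract v E k = k ((E.filter (incB v)).map (other v)) (E.filter fun e => !incB v e) := by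
  induction E generalizing k with
  | nil => rfl
  | cons e E ih =>
    change (Bool.rec
        (Bool.rec (extract v E fun N R => k N (e :: R)) (extract v E fun N R => k (e.1 :: N) R)
          (Nat.beq v e.2))
        (extract v E fun N R => k (e.2 :: N) R) (Nat.beq v e.1) : Bool) = _
    rw [ih, ih, ih]
    cases h₁ : Nat.beq v e.1 <;> cases h₂ : Nat.beq v e.2 <;> simp [incB, other, h₁, h₂]

/-- If exactly two edges end in `v`, replace them by a single edge; pass the result to `k`. -/
noncomputable def suppress (v : ℕ) (E : List (ℕ × ℕ)) (k : List (ℕ × ℕ) → Bool) : Bool :=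
  extract v E fun N R =>
    match N with
    | [x, y] => bif Nat.beq x y then k E else k ((x, y) :: R)
    | _ => k E

theorem Occurs.exists_of_suppress {n : ℕ} {C : ℕ → Bool} {E : List (ℕ × ℕ)}
    (h : Occurs ⟨n, C, E⟩ G κ) {v : ℕ} {k : List (ℕ × ℕ) → Bool} (hk : suppress v E k = true) :
    ∃ E', Occurs ⟨n, C, E'⟩ G κ ∧ k E' = true := by
  rw [Pattern.suppress, extract_eq] at hk
  split at hk
  case h_2 => exact ⟨E, h, hk⟩
  case h_1 x y hf =>
  rw [Bool.cond_eq_ite] at hk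
  split_ifs at hk with hc
  · exact ⟨E, h, hk⟩
  refine ⟨_, ?_, hk⟩
  obtain ⟨e, l, hf, hx, hl⟩ := List.map_eq_cons_iff.1 hf
  obtain ⟨e', l, rfl, hy, hl⟩ := List.map_eq_cons_iff.1 hl
  obtain rfl := List.map_eq_nil_iff.1 hl
  rw [Nat.beq_eq] at hc
  have hve : e ∈ E ∧ Inc v e := by
    have : e ∈ E.filter (incB v) := by simp [hf]
    simpa [incB_iff] using this
  have hve' : e' ∈ E ∧ Inc v e' := by
    have : e' ∈ E.filter (incB v) := by simp [hf]
    simpa [incB_iff] using this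
  obtain ⟨f, S, h⟩ := h
  have hne := h.ne
  have hex := other_spec hve.2
  have hey := other_spec hve'.2
  rw [hx] at hex
  rw [hy] at hey
  have hox : ∀ i, Inc i e ↔ i = v ∨ i = x := by grind
  have hoy : ∀ i, Inc i e' ↔ i = v ∨ i = y := by grind
  have hpx : G.IsPathSet (f x) (f v) (S e) := by
    have := h.path e hve.1
    have := this.symm
    grind
  have hpy : G.IsPathSet (f v) (f y) (S e') := by
    have := h.path e' hve'.1
    have := this.symm
    grind
  have hxy : e ≠ e' := by grind
  have hp : G.IsPathSet (f x) (f y) (S e ∪ S e') := by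
    refine hpx.trans hpy fun t ht => ?_
    obtain ⟨i, rfl, hi, hi'⟩ := h.meet e hve.1 e' hve'.1 hxy t ht.1 ht.2
    have : i = v := by grind
    exact this ▸ rfl
  have hold : ∀ d ∈ (x, y) :: E.filter fun d => !incB v d, d ≠ (x, y) → d ∈ E ∧ ¬ Inc v d := by
    intro d hd hne
    rw [List.mem_cons, List.mem_filter, Bool.not_eq_true', ← Bool.not_eq_true, incB_iff] at hd
    exact hd.resolve_left hne
  have hinc : ∀ d ∈ (x, y) :: E.filter fun d => !incB v d, ∀ i, Inc i d →
      ∃ d' ∈ E, Inc i d' := by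
    intro d hd i hi
    by_cases hdx : d = (x, y)
    · subst hdx
      rcases hi with rfl | rfl
      exacts [⟨e, hve.1, (hox _).2 (Or.inr rfl)⟩, ⟨e', hve'.1, (hoy _).2 (Or.inr rfl)⟩]
    · exact ⟨d, (hold d hd hdx).1, hi⟩
  have hmeet : ∀ d ∈ E, ¬ Inc v d → ∀ t ∈ S e ∪ S e', t ∈ S d →
      ∃ i, t = f i ∧ Inc i (x, y) ∧ Inc i d := by
    intro d hd hvd t ht htd
    rcases ht with ht | ht
    · obtain ⟨i, hi, hie, hid⟩ := h.meet e hve.1 d hd (by grind) t ht htd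
      exact ⟨i, hi, by grind, hid⟩
    · obtain ⟨i, hi, hie, hid⟩ := h.meet e' hve'.1 d hd (by grind) t ht htd
      exact ⟨i, hi, by grind, hid⟩
  refine ⟨f, fun d => if d = (x, y) then S e ∪ S e' else S d, ?_, ?_, ?_, ?_, ?_, ?_⟩
  · intro d hd i hi
    obtain ⟨d', hd', hi'⟩ := hinc d hd i hi
    exact h.lt d' hd' i hi'
  · intro d hd
    by_cases hdx : d = (x, y)
    · simpa [hdx] using hc
    · exact hne d (hold d hd hdx).1
  · intro d hd d' hd' i j hi hj
    obtain ⟨c, hc, hi⟩ := hinc d hd i hi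
    obtain ⟨c', hc', hj⟩ := hinc d' hd' j hj
    exact h.inj c hc c' hc' i j hi hj
  · intro d hd i hi
    obtain ⟨d', hd', hi'⟩ := hinc d hd i hi
    exact h.color_eq d' hd' i hi'
  · intro d hd
    by_cases hdx : d = (x, y)
    · simpa [hdx] using hp
    · simpa [hdx] using h.path d (hold d hd hdx).1
  · intro d hd d' hd' hdd t ht ht'
    by_cases hdx : d = (x, y) <;> by_cases hdx' : d' = (x, y)
    · exact absurd (hdx.trans hdx'.symm) hdd
    · simp only [hdx, hdx', if_true, if_false] at ht ht'
      subst hdx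
      exact hmeet d' (hold d' hd' hdx').1 (hold d' hd' hdx').2 t ht ht'
    · simp only [hdx, hdx', if_true, if_false] at ht ht'
      subst hdx'
      obtain ⟨i, hi, h1, h2⟩ := hmeet d (hold d hd hdx).1 (hold d hd hdx).2 t ht' ht
      exact ⟨i, hi, h2, h1⟩
    · simp only [hdx, hdx', if_false] at ht ht'
      exact h.meet d (hold d hd hdx).1 d' (hold d' hd' hdx').1 hdd t ht ht'

/-- Suppress all vertices below `n` that have degree two. -/
noncomputable def suppressAll (n : ℕ) (E : List (ℕ × ℕ)) (k : List (ℕ × ℕ) → Bool) : Bool :=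
  Nat.rec (motive := fun _ => List (ℕ × ℕ) → Bool) k (fun v r E => suppress v E r) n E

theorem Occurs.exists_of_suppressAll {n : ℕ} {C : ℕ → Bool} {k : List (ℕ × ℕ) → Bool} {m : ℕ} :
    ∀ {E : List (ℕ × ℕ)}, Occurs ⟨n, C, E⟩ G κ → suppressAll m E k = true →
      ∃ E', Occurs ⟨n, C, E'⟩ G κ ∧ k E' = true := by
  induction m with
  | zero => exact fun h hk => ⟨_, h, hk⟩
  | succ v ih =>
    intro E h hk
    obtain ⟨E', h, hk⟩ := h.exists_of_suppress (k := fun E => suppressAll v E k) hk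
    exact ih h hk

/-- Give the vertex `n` the colour `c`. -/
noncomputable def recolor (n : ℕ) (c : Bool) (C : ℕ → Bool) (i : ℕ) : Bool :=
  Bool.rec (C i) c (Nat.beq i n)

theorem recolor_of_lt {n : ℕ} {c : Bool} {C : ℕ → Bool} {i : ℕ} (h : i < n) :
    recolor n c C i = C i := by
  have : Nat.beq i n = false := by simp [← Bool.not_eq_true, h.ne]
  rw [recolor, this]

theorem recolor_self {n : ℕ} {c : Bool} {C : ℕ → Bool} : recolor n c C n = c := by
  have : Nat.beq n n = true := by simp
  rw [recolor, this]

/-- Remove the edge `l`. -/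
noncomputable def removeEdge (l : ℕ × ℕ) (E : List (ℕ × ℕ)) : List (ℕ × ℕ) :=
  List.rec [] (fun e _ r => Bool.rec (e :: r) (Bool.rec (e :: r) r (Nat.beq e.2 l.2))
    (Nat.beq e.1 l.1)) E

theorem mem_removeEdge {E : List (ℕ × ℕ)} {e l : ℕ × ℕ} :
    e ∈ removeEdge l E ↔ e ∈ E ∧ e ≠ l := by
  induction E with
  | nil => simp [removeEdge]
  | cons d E ih =>
    change e ∈ (Bool.rec (d :: removeEdge l E)
      (Bool.rec (d :: removeEdge l E) (removeEdge l E) (Nat.beq d.2 l.2))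
      (Nat.beq d.1 l.1) : List (ℕ × ℕ)) ↔ _
    have hd : d = l ↔ Nat.beq d.1 l.1 = true ∧ Nat.beq d.2 l.2 = true := by
      rw [Nat.beq_eq, Nat.beq_eq, Prod.ext_iff]
    revert hd
    cases Nat.beq d.1 l.1 <;> cases Nat.beq d.2 l.2 <;> simp only [List.mem_cons, ih] <;> grind

/-- Subdivide the edge `l` by a new vertex of colour `c`. -/
noncomputable def subdivide (P : Pattern) (l : ℕ × ℕ) (c : Bool) : Pattern :=
  ⟨Nat.succ P.size, recolor P.size c P.color, (l.1, P.size) :: (P.size, l.2) ::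
    removeEdge l P.edges⟩

/-- Subdivide the edge `k` by a new vertex of colour `c` and join it to the vertex `s`. -/
noncomputable def attach (P : Pattern) (k : ℕ × ℕ) (s : ℕ) (c : Bool) : Pattern :=
  ⟨Nat.succ P.size, recolor P.size c P.color, (k.1, P.size) :: (P.size, k.2) :: (P.size, s) ::
    removeEdge k P.edges⟩

theorem IsModel.subdivide (h : P.IsModel G κ f S) {l : ℕ × ℕ} (hl : l ∈ P.edges) {z : V}
    (hz : z ∈ S l) (hz₁ : z ≠ f l.1) (hz₂ : z ≠ f l.2) :
    ∃ f' S', (P.subdivide l (κ z)).IsModel G κ f' S' ∧ (∀ i < P.size, f' i = f i) ∧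
      f' P.size = z ∧ ∀ e ∈ (P.subdivide l (κ z)).edges,
        S' e ⊆ S l ∨ e ∈ P.edges ∧ e ≠ l ∧ S' e = S e := by
  obtain ⟨S₁, S₂, h₁, h₂, hU, hI⟩ := (h.path l hl).split hz
  set n := P.size with hn
  have hlt : ∀ e ∈ P.edges, e.1 < n ∧ e.2 < n := fun e he =>
    ⟨h.lt e he _ (Or.inl rfl), h.lt e he _ (Or.inr rfl)⟩
  have hmem : ∀ e ∈ (P.subdivide l (κ z)).edges,
      e = (l.1, n) ∨ e = (n, l.2) ∨ e ∈ P.edges ∧ e ≠ l := by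
    intro e he
    simpa only [Pattern.subdivide, List.mem_cons, mem_removeEdge] using he
  let f' : ℕ → V := fun i => if i = n then z else f i
  let S' : ℕ × ℕ → Set V := fun e => if e.2 = n then S₁ else if e.1 = n then S₂ else S e
  have hf' : ∀ i < n, f' i = f i := fun i hi => if_neg hi.ne
  have hfn : f' n = z := if_pos rfl
  have hS₁ : S' (l.1, n) = S₁ := if_pos rfl
  have hS₂ : S' (n, l.2) = S₂ := by
    simp only [S', (hlt l hl).2.ne, if_false, if_true]
  have hS : ∀ e ∈ P.edges, S' e = S e := fun e he => by
    simp only [S', (hlt e he).1.ne, (hlt e he).2.ne, if_false]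
  have hsub₁ : S₁ ⊆ S l := hU ▸ Set.subset_union_left
  have hsub₂ : S₂ ⊆ S l := hU ▸ Set.subset_union_right
  have hfresh : ∀ e ∈ P.edges, ∀ i, Inc i e → f i ≠ z := by
    rintro e he i hi rfl
    rcases h.inc_of_mem he hl hi hz with rfl | rfl
    exacts [hz₁ rfl, hz₂ rfl]
  have hinc : ∀ e ∈ (P.subdivide l (κ z)).edges, ∀ i, Inc i e →
      i = n ∨ i < n ∧ ∃ d ∈ P.edges, Inc i d := by
    intro e he i hi
    have := hlt l hl
    rcases hmem e he with rfl | rfl | ⟨he, -⟩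
    · rcases hi with rfl | rfl
      exacts [Or.inr ⟨this.1, l, hl, Or.inl rfl⟩, Or.inl rfl]
    · rcases hi with rfl | rfl
      exacts [Or.inl rfl, Or.inr ⟨this.2, l, hl, Or.inr rfl⟩]
    · exact Or.inr ⟨h.lt e he i hi, e, he, hi⟩
  have hl₂ : f l.2 ∉ S₁ := fun hm => hz₂ (hI ⟨hm, h₂.right_mem⟩ : f l.2 = z).symm
  have hl₁ : f l.1 ∉ S₂ := fun hm => hz₁ (hI ⟨h₁.left_mem, hm⟩ : f l.1 = z).symm
  have hm₁ : ∀ e ∈ P.edges, e ≠ l → ∀ x ∈ S₁, x ∈ S e → x = f l.1 ∧ Inc l.1 e := by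
    intro e he hne x hx hxe
    obtain ⟨i, rfl, hi, hi'⟩ := h.meet l hl e he hne.symm x (hsub₁ hx) hxe
    rcases hi with rfl | rfl
    exacts [⟨rfl, hi'⟩, absurd hx hl₂]
  have hm₂ : ∀ e ∈ P.edges, e ≠ l → ∀ x ∈ S₂, x ∈ S e → x = f l.2 ∧ Inc l.2 e := by
    intro e he hne x hx hxe
    obtain ⟨i, rfl, hi, hi'⟩ := h.meet l hl e he hne.symm x (hsub₂ hx) hxe
    rcases hi with rfl | rfl
    exacts [absurd hx hl₁, ⟨rfl, hi'⟩]
  refine ⟨f', S', ⟨?_, ?_, ?_, ?_, ?_, ?_⟩, hf', hfn, ?_⟩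
  · intro e he i hi
    have := hinc e he i hi
    simp only [Pattern.subdivide, Nat.succ_eq_add_one]
    omega
  · intro e he
    have := hlt l hl
    rcases hmem e he with rfl | rfl | ⟨he, -⟩
    exacts [this.1.ne, this.2.ne', h.ne e he]
  · intro e he e' he' i j hi hj hij
    rcases hinc e he i hi with rfl | ⟨hin, d, hd, hid⟩ <;>
      rcases hinc e' he' j hj with rfl | ⟨hjn, d', hd', hjd⟩
    · rfl
    · rw [hfn, hf' j hjn] at hij
      exact absurd hij.symm (hfresh d' hd' j hjd)
    · rw [hfn, hf' i hin] at hij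
      exact absurd hij (hfresh d hd i hid)
    · rw [hf' i hin, hf' j hjn] at hij
      exact h.inj d hd d' hd' i j hid hjd hij
  · intro e he i hi
    rcases hinc e he i hi with rfl | ⟨hin, d, hd, hid⟩
    · rw [hfn]
      exact recolor_self.symm
    · rw [hf' i hin, h.color_eq d hd i hid]
      exact (recolor_of_lt hin).symm
  · intro e he
    rcases hmem e he with rfl | rfl | ⟨he, -⟩
    · rw [hS₁, hfn, hf' _ (hlt l hl).1]
      exact h₁
    · rw [hS₂, hfn, hf' _ (hlt l hl).2]
      exact h₂
    · rw [hS e he, hf' _ (hlt e he).1, hf' _ (hlt e he).2]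
      exact h.path e he
  · intro e he e' he' hne x hx hx'
    rcases hmem e he with rfl | rfl | ⟨he, hel⟩ <;>
      rcases hmem e' he' with rfl | rfl | ⟨he', hel'⟩
    · exact absurd rfl hne
    · rw [hS₁] at hx
      rw [hS₂] at hx'
      exact ⟨n, hfn.symm ▸ hI ⟨hx, hx'⟩, Or.inr rfl, Or.inl rfl⟩
    · rw [hS₁] at hx
      rw [hS e' he'] at hx'
      obtain ⟨hx, hi⟩ := hm₁ e' he' hel' x hx hx'
      exact ⟨l.1, (hf' _ (hlt l hl).1).symm ▸ hx, Or.inl rfl, hi⟩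
    · rw [hS₂] at hx
      rw [hS₁] at hx'
      exact ⟨n, hfn.symm ▸ hI ⟨hx', hx⟩, Or.inl rfl, Or.inr rfl⟩
    · exact absurd rfl hne
    · rw [hS₂] at hx
      rw [hS e' he'] at hx'
      obtain ⟨hx, hi⟩ := hm₂ e' he' hel' x hx hx'
      exact ⟨l.2, (hf' _ (hlt l hl).2).symm ▸ hx, Or.inr rfl, hi⟩
    · rw [hS₁] at hx'
      rw [hS e he] at hx
      obtain ⟨hx, hi⟩ := hm₁ e he hel x hx' hx
      exact ⟨l.1, (hf' _ (hlt l hl).1).symm ▸ hx, hi, Or.inl rfl⟩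
    · rw [hS₂] at hx'
      rw [hS e he] at hx
      obtain ⟨hx, hi⟩ := hm₂ e he hel x hx' hx
      exact ⟨l.2, (hf' _ (hlt l hl).2).symm ▸ hx, hi, Or.inr rfl⟩
    · rw [hS e he] at hx
      rw [hS e' he'] at hx'
      obtain ⟨i, rfl, hi, hi'⟩ := h.meet e he e' he' hne x hx hx'
      exact ⟨i, (hf' _ (h.lt e he i hi)).symm, hi, hi'⟩
  · intro e he
    rcases hmem e he with rfl | rfl | ⟨he, hel⟩
    · exact Or.inl (hS₁ ▸ hsub₁)
    · exact Or.inl (hS₂ ▸ hsub₂)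
    · exact Or.inr ⟨he, hel, hS e he⟩

theorem IsModel.attach (h : P.IsModel G κ f S) {k d : ℕ × ℕ} (hk : k ∈ P.edges)
    (hd : d ∈ P.edges) {s : ℕ} (hs : Inc s d) (hsk : ¬ Inc s k)
    {Y A B R : Set V} {w : V} (hw : w ∉ Y) (hY : ∀ e ∈ P.edges, e ≠ k → S e ⊆ Y)
    (ha : f k.1 ∈ Y) (hb : f k.2 ∈ Y)
    (hF : G.IsFan Y w (f k.1) (f k.2) A B) (hR : G.IsPathSet w (f s) R) (hRY : R ∩ Y ⊆ {f s})
    (hRA : R ∩ A ⊆ {w}) (hRB : R ∩ B ⊆ {w}) : (P.attach k s (κ w)).Occurs G κ := by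
  set n := P.size with hn
  have hlt : ∀ e ∈ P.edges, e.1 < n ∧ e.2 < n := fun e he =>
    ⟨h.lt e he _ (Or.inl rfl), h.lt e he _ (Or.inr rfl)⟩
  have hsn : s < n := h.lt d hd s hs
  have hmem : ∀ e ∈ (P.attach k s (κ w)).edges,
      e = (k.1, n) ∨ e = (n, k.2) ∨ e = (n, s) ∨ e ∈ P.edges ∧ e ≠ k := by
    intro e he
    simpa only [Pattern.attach, List.mem_cons, mem_removeEdge] using he
  have hks : s ≠ k.2 := fun h => hsk (Or.inr h)
  have hdk : d ≠ k := fun h => hsk (h ▸ hs)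
  let f' : ℕ → V := fun i => if i = n then w else f i
  let S' : ℕ × ℕ → Set V := fun e =>
    if e.2 = n then A else if e = (n, k.2) then B else if e = (n, s) then R else S e
  have hf' : ∀ i < n, f' i = f i := fun i hi => if_neg hi.ne
  have hfn : f' n = w := if_pos rfl
  have hSA : S' (k.1, n) = A := if_pos rfl
  have hSB : S' (n, k.2) = B := by
    simp only [S', (hlt k hk).2.ne, if_false, if_true]
  have hSR : S' (n, s) = R := by
    simp [S', hsn.ne, hks]
  have hS : ∀ e ∈ P.edges, S' e = S e := fun e he => by
    have h₁ : e ≠ (n, k.2) := fun h => (hlt e he).1.ne (h ▸ rfl)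
    have h₂ : e ≠ (n, s) := fun h => (hlt e he).1.ne (h ▸ rfl)
    simp only [S', (hlt e he).2.ne, h₁, h₂, if_false]
  have hinc : ∀ e ∈ (P.attach k s (κ w)).edges, ∀ i, Inc i e →
      i = n ∨ i < n ∧ ∃ d ∈ P.edges, Inc i d := by
    intro e he i hi
    have := hlt k hk
    rcases hmem e he with rfl | rfl | rfl | ⟨he, -⟩
    · rcases hi with rfl | rfl
      exacts [Or.inr ⟨this.1, k, hk, Or.inl rfl⟩, Or.inl rfl]
    · rcases hi with rfl | rfl
      exacts [Or.inl rfl, Or.inr ⟨this.2, k, hk, Or.inr rfl⟩]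
    · rcases hi with rfl | rfl
      exacts [Or.inl rfl, Or.inr ⟨hsn, d, hd, hs⟩]
    · exact Or.inr ⟨h.lt e he i hi, e, he, hi⟩
  have hfY : ∀ e ∈ P.edges, ∀ i, Inc i e → f i ∈ Y := by
    intro e he i hi
    by_cases hek : e = k
    · subst hek
      rcases hi with rfl | rfl
      exacts [ha, hb]
    · exact hY e he hek (h.mem_of_inc he hi)
  have hend : ∀ {Q : Set V} {t : ℕ} {c : ℕ × ℕ}, Q ∩ Y ⊆ {f t} → c ∈ P.edges → Inc t c →
      ∀ e ∈ P.edges, e ≠ k → ∀ x ∈ Q, x ∈ S e → x = f' t ∧ Inc t e := by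
    intro Q t c hQ hc ht e he hek x hx hxe
    have hxt : x = f t := hQ ⟨hx, hY e he hek hxe⟩
    exact ⟨(hf' t (h.lt c hc t ht)).symm ▸ hxt, h.inc_of_mem hc he ht (hxt ▸ hxe)⟩
  have hendA := hend hF.left_inter hk (Or.inl rfl)
  have hendB := hend hF.right_inter hk (Or.inr rfl)
  have hendR := hend hRY hd hs
  have hAB := hF.inter
  refine ⟨f', S', ?_, ?_, ?_, ?_, ?_, ?_⟩
  · intro e he i hi
    have := hinc e he i hi
    simp only [Pattern.attach, Nat.succ_eq_add_one]
    omega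
  · intro e he
    have := hlt k hk
    rcases hmem e he with rfl | rfl | rfl | ⟨he, -⟩
    exacts [this.1.ne, this.2.ne', hsn.ne', h.ne e he]
  · intro e he e' he' i j hi hj hij
    rcases hinc e he i hi with rfl | ⟨hin, d, hd, hid⟩ <;>
      rcases hinc e' he' j hj with rfl | ⟨hjn, d', hd', hjd⟩
    · rfl
    · rw [hfn, hf' j hjn] at hij
      exact absurd (hij ▸ hfY d' hd' j hjd) hw
    · rw [hfn, hf' i hin] at hij
      exact absurd (hij ▸ hfY d hd i hid) hw
    · rw [hf' i hin, hf' j hjn] at hij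
      exact h.inj d hd d' hd' i j hid hjd hij
  · intro e he i hi
    rcases hinc e he i hi with rfl | ⟨hin, d, hd, hid⟩
    · rw [hfn]
      exact recolor_self.symm
    · rw [hf' i hin, h.color_eq d hd i hid]
      exact (recolor_of_lt hin).symm
  · intro e he
    rcases hmem e he with rfl | rfl | rfl | ⟨he, -⟩
    · rw [hSA, hfn, hf' _ (hlt k hk).1]
      exact hF.left.symm
    · rw [hSB, hfn, hf' _ (hlt k hk).2]
      exact hF.right
    · rw [hSR, hfn, hf' _ hsn]
      exact hR
    · rw [hS e he, hf' _ (hlt e he).1, hf' _ (hlt e he).2]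
      exact h.path e he
  · simp only [Set.subset_def, Set.mem_inter_iff, Set.mem_singleton_iff] at hAB hRA hRB
    intro e he e' he' hne x hx hx'
    rcases hmem e he with rfl | rfl | rfl | ⟨he, hek⟩ <;>
      rcases hmem e' he' with rfl | rfl | rfl | ⟨he', hek'⟩ <;>
      try simp only [hSA, hSB, hSR] at hx hx'
    all_goals first
      | exact absurd rfl hne
      | exact ⟨n, hfn.symm ▸ hAB x ⟨‹_›, ‹_›⟩, by simp [Inc], by simp [Inc]⟩
      | exact ⟨n, hfn.symm ▸ hRA x ⟨‹_›, ‹_›⟩, by simp [Inc], by simp [Inc]⟩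
      | exact ⟨n, hfn.symm ▸ hRB x ⟨‹_›, ‹_›⟩, by simp [Inc], by simp [Inc]⟩
      | skip
    · rw [hS e' he'] at hx'
      exact ⟨_, (hendA e' he' hek' x hx hx').1, Or.inl rfl, (hendA e' he' hek' x hx hx').2⟩
    · rw [hS e' he'] at hx'
      exact ⟨_, (hendB e' he' hek' x hx hx').1, Or.inr rfl, (hendB e' he' hek' x hx hx').2⟩
    · rw [hS e' he'] at hx'
      exact ⟨_, (hendR e' he' hek' x hx hx').1, Or.inr rfl, (hendR e' he' hek' x hx hx').2⟩
    · rw [hS e he] at hx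
      exact ⟨_, (hendA e he hek x hx' hx).1, (hendA e he hek x hx' hx).2, Or.inl rfl⟩
    · rw [hS e he] at hx
      exact ⟨_, (hendB e he hek x hx' hx).1, (hendB e he hek x hx' hx).2, Or.inr rfl⟩
    · rw [hS e he] at hx
      exact ⟨_, (hendR e he hek x hx' hx).1, (hendR e he hek x hx' hx).2, Or.inr rfl⟩
    · rw [hS e he] at hx
      rw [hS e' he'] at hx'
      obtain ⟨i, rfl, hi, hi'⟩ := h.meet e he e' he' hne x hx hx'
      exact ⟨i, (hf' _ (h.lt e he i hi)).symm, hi, hi'⟩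

/-- The patterns obtained by subdividing the edge `k` and joining the new vertex to a vertex that
is not an end of `k`, or to a new vertex on another edge. -/
noncomputable def children (P : Pattern) (k : ℕ × ℕ) : List Pattern :=
  (((List.range P.size).filter fun s => !incB s k).map fun s =>
    P.attach k s (!P.color k.1)) ++
  (removeEdge k P.edges).flatMap fun l =>
    [(P.subdivide l false).attach k P.size (!P.color k.1),
      (P.subdivide l true).attach k P.size (!P.color k.1)]

theorem attach_mem_children {k : ℕ × ℕ} {s : ℕ} (hs : s < P.size) (hsk : ¬ Inc s k) :
    P.attach k s (!P.color k.1) ∈ P.children k := by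
  refine List.mem_append_left _ (List.mem_map_of_mem (List.mem_filter.2 ⟨by simpa, ?_⟩))
  rwa [Bool.not_eq_true', ← Bool.not_eq_true, incB_iff]

theorem subdivide_attach_mem_children {k l : ℕ × ℕ} (hl : l ∈ P.edges) (hlk : l ≠ k) (c : Bool) :
    (P.subdivide l c).attach k P.size (!P.color k.1) ∈ P.children k := by
  refine List.mem_append_right _
    (List.mem_flatMap.2 ⟨l, mem_removeEdge.2 ⟨hl, hlk⟩, ?_⟩)
  cases c <;> simp

/-- If the ends of `k` have the same colour, then by 3-connectivity some child of `P` occurs. -/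
theorem Occurs.exists_child [Finite V] (hκ : ∀ x y, G.Adj x y → κ x ≠ κ y)
    (hconn : ∀ a b : V, (G.induce ({a, b} : Set V)ᶜ).Connected) (h : P.Occurs G κ)
    {k d : ℕ × ℕ} (hk : k ∈ P.edges) (hd : d ∈ P.edges) {j : ℕ} (hj : Inc j d) (hjk : ¬ Inc j k)
    (hcol : P.color k.1 = P.color k.2) :
    ∃ Q ∈ P.children k, Q.Occurs G κ := by
  obtain ⟨f, S, h⟩ := h
  have hk₁ : Inc k.1 k := Or.inl rfl
  have hk₂ : Inc k.2 k := Or.inr rfl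
  have hfk : f k.1 ≠ f k.2 := fun he => h.ne k hk (h.inj k hk k hk _ _ hk₁ hk₂ he)
  obtain ⟨w, hwS, hadj⟩ := (h.path k hk).exists_adj hfk
  have hκw : κ w = !P.color k.1 := by
    have := hκ _ _ hadj
    rw [h.color_eq k hk _ hk₁] at this
    revert this
    cases κ w <;> cases P.color k.1 <;> simp
  have hw₁ : w ≠ f k.1 := hadj.ne'
  have hw₂ : w ≠ f k.2 := by
    rintro rfl
    rw [h.color_eq k hk _ hk₂, hcol] at hκw
    simp at hκw
  obtain ⟨A, B, hA, hB, hAB, hI⟩ := (h.path k hk).split hwS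
  let Y : Set V := {x | x = f k.1 ∨ x = f k.2 ∨ ∃ e ∈ P.edges, e ≠ k ∧ x ∈ S e}
  have hkY : ∀ x ∈ S k, x ∈ Y → x = f k.1 ∨ x = f k.2 := by
    rintro x hx (hxk | hxk | ⟨e, he, hek, hxe⟩)
    · exact Or.inl hxk
    · exact Or.inr hxk
    · obtain ⟨i, rfl, -, rfl | rfl⟩ := h.meet e he k hk hek x hxe hx
      exacts [Or.inl rfl, Or.inr rfl]
  have hwY : w ∉ Y := fun hw => (hkY w hwS hw).elim hw₁ hw₂
  have hF : G.IsFan Y w (f k.1) (f k.2) A B := by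
    refine ⟨hA.symm, hB, hI, fun x hx => ?_, fun x hx => ?_⟩
    · refine (hkY x (hAB ▸ Or.inl hx.1) hx.2).resolve_right ?_
      rintro rfl
      exact hw₂ (hI ⟨hx.1, hB.right_mem⟩ : f k.2 = w).symm
    · refine (hkY x (hAB ▸ Or.inr hx.1) hx.2).resolve_left ?_
      rintro rfl
      exact hw₁ (hI ⟨hA.left_mem, hx.1⟩ : f k.1 = w).symm
  have hdk : d ≠ k := fun he => hjk (he ▸ hj)
  obtain ⟨s, hsY, hs₁, hs₂, A, B, R, hF, hR, hRY, hRA, hRB⟩ :=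
    IsFan.hasThreeFan hconn (y := f j) hwY (Or.inl rfl) (Or.inr (Or.inl rfl)) hfk
      (Or.inr (Or.inr ⟨d, hd, hdk, h.mem_of_inc hd hj⟩))
      (fun he => hjk (Or.inl (h.inj d hd k hk _ _ hj hk₁ he)))
      (fun he => hjk (Or.inr (h.inj d hd k hk _ _ hj hk₂ he))) hF
  obtain ⟨l, hl, hlk, hsl⟩ := (hsY.resolve_left hs₁).resolve_left hs₂
  by_cases hsf : ∃ i, Inc i l ∧ s = f i
  · obtain ⟨i, hi, rfl⟩ := hsf
    have hik : ¬ Inc i k := by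
      rintro (rfl | rfl)
      exacts [hs₁ rfl, hs₂ rfl]
    refine ⟨_, attach_mem_children (h.lt l hl i hi) hik, hκw ▸ ?_⟩
    exact h.attach hk hl hi hik hwY (fun e he hek x hx => Or.inr (Or.inr ⟨e, he, hek, hx⟩))
      (Or.inl rfl) (Or.inr (Or.inl rfl)) hF hR hRY hRA hRB
  · obtain ⟨f', S', h', hf', hfn, hS'⟩ := h.subdivide hl hsl
      (fun he => hsf ⟨_, Or.inl rfl, he⟩) (fun he => hsf ⟨_, Or.inr rfl, he⟩)
    refine ⟨_, subdivide_attach_mem_children hl hlk (κ s), hκw ▸ ?_⟩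
    have hkn₁ := h.lt k hk _ hk₁
    have hkn₂ := h.lt k hk _ hk₂
    have hf₁ := hf' _ hkn₁
    have hf₂ := hf' _ hkn₂
    refine h'.attach (d := (l.1, P.size)) (Y := Y) (A := A) (B := B) (R := R) ?_ ?_
      (Or.inr rfl) ?_ hwY ?_ ?_ ?_ ?_ ?_ ?_ hRA hRB
    · exact List.mem_cons_of_mem _ (List.mem_cons_of_mem _ (mem_removeEdge.2 ⟨hk, hlk.symm⟩))
    · exact List.mem_cons_self
    · rintro (he | he)
      exacts [hkn₁.ne' he, hkn₂.ne' he]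
    · intro e he hek x hx
      rcases hS' e he with hsub | ⟨he, -, hSe⟩
      · exact Or.inr (Or.inr ⟨l, hl, hlk, hsub hx⟩)
      · exact Or.inr (Or.inr ⟨e, he, hek, hSe ▸ hx⟩)
    · exact Or.inl hf₁
    · exact Or.inr (Or.inl hf₂)
    · rwa [hf₁, hf₂]
    · rwa [hfn]
    · rwa [hfn]

/-- Membership of a vertex. -/
noncomputable def memVertex (x : ℕ) (N : List ℕ) : Bool :=
  List.rec false (fun y _ r => Bool.rec r true (Nat.beq x y)) N

theorem memVertex_iff {x : ℕ} {N : List ℕ} : memVertex x N = true ↔ x ∈ N := by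
  induction N with
  | nil => simp [memVertex]
  | cons y N ih =>
    rw [List.mem_cons, ← ih, ← Nat.beq_eq]
    change Bool.rec (memVertex x N) true (Nat.beq x y) = true ↔ _
    cases Nat.beq x y <;> simp

/-- The number of bichromatic pairs in `A × B`. -/
def bichromatic (C : ℕ → Bool) (A B : List ℕ) : ℕ :=
  (A.map fun a => (B.map fun b => bif C a ^^ C b then 1 else 0).sum).sum

/-- The edges contain a copy of `K_{3,3}` around the first edge, with at least `thr` bichromatic
edges. -/
noncomputable def isHex (thr : ℕ) (C : ℕ → Bool) (E : List (ℕ × ℕ)) : Bool :=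
  match E with
  | [] => false
  | e :: _ => extract e.2 E fun A _ => extract e.1 E fun B _ =>
    match A, B with
    | [a₀, a₁, a₂], [b₀, b₁, b₂] =>
      !(Nat.beq a₀ a₁ || Nat.beq a₀ a₂ || Nat.beq a₁ a₂ || Nat.beq b₀ b₁ || Nat.beq b₀ b₂ ||
        Nat.beq b₁ b₂) &&
      ([a₀, a₁, a₂].all fun a => extract a E fun N _ =>
        memVertex b₀ N && memVertex b₁ N && memVertex b₂ N) &&
      Nat.ble thr (bichromatic C [a₀, a₁, a₂] [b₀, b₁, b₂])
    | _, _ => false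

theorem mem_neighbors {E : List (ℕ × ℕ)} {a b : ℕ}
    (h : b ∈ (E.filter (incB a)).map (other a)) : (a, b) ∈ E ∨ (b, a) ∈ E := by
  obtain ⟨e, he, rfl⟩ := List.mem_map.1 h
  rw [List.mem_filter, incB_iff] at he
  rcases other_spec he.2 with ⟨h₁, h₂⟩ | ⟨h₁, h₂⟩
  · rw [h₂, h₁]
    exact Or.inl he.1
  · rw [h₂, h₁]
    exact Or.inr he.1

theorem odd_length_iff (hκ : ∀ x y, G.Adj x y → κ x ≠ κ y) {x y : V}
    (p : G.Walk x y) : Odd p.length ↔ κ x ≠ κ y := by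
  let c : G.Coloring Bool := Coloring.mk κ fun {x y} h => hκ x y h
  rw [c.odd_length_iff_not_congr p]
  change (¬ κ x ↔ κ y) ↔ _
  cases κ x <;> cases κ y <;> simp

/-- A model of `K_{3,3}` gives a hex. -/
theorem IsModel.exists_hex (hκ : ∀ x y, G.Adj x y → κ x ≠ κ y) (h : P.IsModel G κ f S)
    {a b : Fin 3 → ℕ} (ha : Function.Injective a) (hb : Function.Injective b)
    (hab : ∀ i j, a i ≠ b j) (hE : ∀ i j, (a i, b j) ∈ P.edges ∨ (b j, a i) ∈ P.edges) :
    ∃ H : G.Hex, H.oddCount =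
      ∑ i, ∑ j, bif P.color (a i) ^^ P.color (b j) then 1 else 0 := by
  have key : ∀ i j, ∃ e ∈ P.edges, (∀ t, Inc t e ↔ t = a i ∨ t = b j) ∧
      G.IsPathSet (f (a i)) (f (b j)) (S e) := by
    intro i j
    rcases hE i j with he | he
    · exact ⟨_, he, fun t => Iff.rfl, h.path _ he⟩
    · exact ⟨_, he, fun t => or_comm, (h.path _ he).symm⟩
  choose e he hinc hpath using key
  choose p hp hsupp using hpath
  have hia : ∀ i j, Inc (a i) (e i j) := fun i j => (hinc i j _).2 (Or.inl rfl)
  have hib : ∀ i j, Inc (b j) (e i j) := fun i j => (hinc i j _).2 (Or.inr rfl)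
  let H : G.Hex :=
    { fA := fun i => f (a i)
      fB := fun j => f (b j)
      injA := fun i i' hii => ha (h.inj _ (he i 0) _ (he i' 0) _ _ (hia i 0) (hia i' 0) hii)
      injB := fun j j' hjj => hb (h.inj _ (he 0 j) _ (he 0 j') _ _ (hib 0 j) (hib 0 j') hjj)
      disjAB := fun i j hij =>
        hab i j (h.inj _ (he i j) _ (he i j) _ _ (hia i j) (hib i j) hij)
      seg := p
      seg_path := hp
      seg_meet := by
        intro i j i' j' hne x hx hx'
        have hee : e i j ≠ e i' j' := by
          intro hee
          have h₁ := hia i j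
          have h₂ := hib i j
          rw [hee, hinc] at h₁ h₂
          exact hne (Prod.ext (ha (h₁.resolve_right (hab i j')))
            (hb (h₂.resolve_left (hab i' j).symm)))
        obtain ⟨t, rfl, ht, ht'⟩ := h.meet _ (he i j) _ (he i' j') hee x
          ((hsupp i j x).2 hx) ((hsupp i' j' x).2 hx')
        rw [hinc] at ht ht'
        rcases ht with rfl | rfl
        · exact Or.inl ⟨rfl, ha (ht'.resolve_right (hab i j'))⟩
        · exact Or.inr ⟨rfl, hb (ht'.resolve_left (hab i' j).symm)⟩ }
  refine ⟨H, ?_⟩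
  rw [Hex.oddCount, Finset.card_filter, ← Finset.univ_product_univ, Finset.sum_product]
  refine Finset.sum_congr rfl fun i _ => Finset.sum_congr rfl fun j _ => ?_
  rw [if_congr (odd_length_iff hκ (p i j)) rfl rfl, h.color_eq _ (he i j) _ (hia i j),
    h.color_eq _ (he i j) _ (hib i j)]
  cases P.color (a i) <;> cases P.color (b j) <;> rfl

theorem Occurs.exists_hex_of_isHex (hκ : ∀ x y, G.Adj x y → κ x ≠ κ y) {n : ℕ} {C : ℕ → Bool}
    {E : List (ℕ × ℕ)} (h : Occurs ⟨n, C, E⟩ G κ) {thr : ℕ} (hE : isHex thr C E = true) :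
    ∃ H : G.Hex, thr ≤ H.oddCount := by
  obtain ⟨f, S, h⟩ := h
  unfold isHex at hE
  split at hE
  · simp at hE
  rename_i E e E'
  simp only [extract_eq] at hE
  split at hE
  · rename_i a₀ a₁ a₂ b₀ b₁ b₂ _ _
    simp only [Bool.and_eq_true, Bool.not_eq_true', List.all_cons, List.all_nil, Bool.and_true,
      Bool.or_eq_true, memVertex_iff, ← Bool.not_eq_true, Nat.beq_eq, Nat.ble_eq, not_or] at hE
    obtain ⟨⟨hne, hmem⟩, hthr⟩ := hE
    have hE : ∀ i j : Fin 3, (![a₀, a₁, a₂] i, ![b₀, b₁, b₂] j) ∈ e :: E' ∨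
        (![b₀, b₁, b₂] j, ![a₀, a₁, a₂] i) ∈ e :: E' := by
      intro i j
      apply mem_neighbors
      fin_cases i <;> fin_cases j <;> simp_all
    obtain ⟨H, hH⟩ := h.exists_hex hκ (a := ![a₀, a₁, a₂]) (b := ![b₀, b₁, b₂])
      (by simp [Function.Injective, Fin.forall_fin_succ]; grind)
      (by simp [Function.Injective, Fin.forall_fin_succ]; grind)
      (fun i j => (hE i j).elim (h.ne _) fun he => (h.ne _ he).symm) hE
    refine ⟨H, hH ▸ hthr.trans (le_of_eq ?_)⟩
    simp [bichromatic, Fin.sum_univ_succ]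
  · simp at hE

/-- Check a certificate that every graph containing `P` contains a hex with at least `thr` odd
segments, and return the unused part of the certificate. An even entry selects the edges of a
hex, an odd entry selects an edge to which the fan argument is applied. -/
noncomputable def check (thr : ℕ) : ℕ → Pattern → List ℕ → Option (List ℕ)
  | 0, _, _ => none
  | _ + 1, _, [] => none
  | d + 1, P, t :: ts =>
    bif t % 2 == 0 then
      bif select (t / 2) P.edges fun E => suppressAll P.size E (isHex thr P.color) then some ts
      else none
    else
      match P.edges[t / 2]? with
      | none => none
      | some k =>
        bif !(P.color k.1 ^^ P.color k.2) &&
            P.edges.any (fun e => !incB e.1 k || !incB e.2 k) then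
          (P.children k).foldl (fun o Q => o.bind (check thr d Q)) (some ts)
        else none

theorem foldl_bind_eq_some {α β : Type*} {g : α → β → Option β} :
    ∀ {l : List α} {o : Option β} {b : β}, l.foldl (fun o a => o.bind (g a)) o = some b →
      (∃ c, o = some c) ∧ ∀ a ∈ l, ∃ c c', g a c = some c'
  | [], o, b, h => ⟨⟨b, h⟩, by simp⟩
  | a :: l, o, b, h => by
    obtain ⟨⟨c, hc⟩, hl⟩ := foldl_bind_eq_some (l := l) h
    obtain ⟨c₀, rfl, hc₀⟩ := Option.bind_eq_some_iff.1 hc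
    exact ⟨⟨c₀, rfl⟩, List.forall_mem_cons.2 ⟨⟨c₀, c, hc₀⟩, hl⟩⟩

theorem Occurs.exists_hex_of_check [Finite V] (hκ : ∀ x y, G.Adj x y → κ x ≠ κ y)
    (hconn : ∀ a b : V, (G.induce ({a, b} : Set V)ᶜ).Connected) {thr : ℕ} :
    ∀ {d : ℕ} {P : Pattern} {ts ts' : List ℕ}, P.check thr d ts = some ts' → P.Occurs G κ →
      ∃ H : G.Hex, thr ≤ H.oddCount
  | 0, P, ts, ts', h, _ => by simp [check] at h
  | d + 1, P, [], ts', h, _ => by simp [check] at h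
  | d + 1, P, t :: ts, ts', h, hP => by
    rw [check, Bool.cond_eq_ite] at h
    split_ifs at h with ht
    · rw [Bool.cond_eq_ite] at h
      split_ifs at h with hh
      obtain ⟨E, hE, hh⟩ := exists_of_select hh
      obtain ⟨E', hE', hh⟩ := (hP.mono hE).exists_of_suppressAll hh
      exact hE'.exists_hex_of_isHex hκ hh
    · split at h
      · simp at h
      · rename_i k hk
        rw [Bool.cond_eq_ite] at h
        split_ifs at h with hh
        simp only [Bool.and_eq_true, Bool.not_eq_true', List.any_eq_true,
          Bool.or_eq_true, ← Bool.not_eq_true, incB_iff,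
          Bool.xor_iff_ne, ne_eq, not_not] at hh
        obtain ⟨hcol, e, he, hek⟩ := hh
        have hk := List.mem_of_getElem? hk
        obtain ⟨Q, hQ, hQo⟩ : ∃ Q ∈ P.children k, Q.Occurs G κ := by
          rcases hek with hek | hek
          · exact hP.exists_child hκ hconn hk he (Or.inl rfl) hek hcol
          · exact hP.exists_child hκ hconn hk he (Or.inr rfl) hek hcol
        obtain ⟨c, c', hc⟩ := (foldl_bind_eq_some h).2 Q hQ
        exact Occurs.exists_hex_of_check hκ hconn hc hQo

end Pattern

/-- The pattern `K_{3,3}` with sides `{0, 1, 2}` and `{3, 4, 5}` and prescribed colours. -/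
def Pattern.hex (C : List Bool) : Pattern :=
  ⟨6, fun i => C.getD i false, [(0, 3), (0, 4), (0, 5), (1, 3), (1, 4), (1, 5), (2, 3), (2, 4), (2, 5)]⟩

/-- A certificate for improving a hex with no odd segment. -/
def certificateZero : List ℕ :=
  [1, 4030, 3582, 4078, 4062, 8174, 8188, 8174, 8188, 8158, 8186, 7934, 7934, 7934, 7934, 8158,
   8186, 6142, 6142, 6142, 6142]

theorem check_certificateZero :
    ((Pattern.hex [false, false, false, false, false, false]).check 1 2
      certificateZero).isSome = true := by
  decide +kernel

/-- A certificate for improving a hex with three odd segments. -/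
def certificateThree : List ℕ :=
  [3, 3966, 3070, 4078, 4062, 8174, 8188, 8174, 8188, 7934, 7934, 8158, 8186, 7678, 7678, 6142,
   6142, 8158, 8186, 4094, 4094]

theorem check_certificateThree :
    ((Pattern.hex [false, false, false, true, false, false]).check 4 2
      certificateThree).isSome = true := by
  decide +kernel

/-- A certificate for improving a hex with four odd segments. -/
def certificateFour : List ℕ :=
  [9, 4062, 3070, 3966, 3838, 7934, 7934, 8158, 8186, 7678, 7166, 8174, 8188, 8174, 8188, 6142,
   7678, 8158, 8186, 4094, 5, 31740, 28668, 16378, 24572, 16380, 16254, 32764, 32734, 32764,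
   32750, 32762, 32734, 32762, 32750, 65374, 65374, 65498, 65498, 65500, 65500, 49148, 49148,
   65500, 65500, 65516, 65516, 65498, 65498]

theorem check_certificateFour :
    ((Pattern.hex [true, false, false, true, false, false]).check 5 3
      certificateFour).isSome = true := by
  decide +kernel

/-- A certificate for improving a hex with five odd segments. -/
def certificateFive : List ℕ :=
  [11, 4030, 2046, 9, 25, 62910, 64574, 45022, 61404, 64954, 60894, 121790, 121726, 121822,
   121822, 129262, 129262, 129246, 129786, 129758, 129786, 130778, 130778, 79870, 97662, 128734,
   128762, 129758, 129758, 127230, 114668, 114542, 114556, 114542, 114556, 13, 17, 257466, 121598,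
   130490, 32190, 122620, 251134, 188346, 376698, 97726, 376698, 376670, 376794, 97662, 502238,
   502238, 502750, 502750, 261866, 261866, 244732, 244702, 244732, 244718, 521946, 521946, 257018,
   256990, 358396, 195326, 259834, 259806, 259834, 128750, 521946, 521946, 40830, 46590, 63934,
   46590, 64956, 129916, 129902, 64494, 93182, 96510, 80894, 97022, 93182, 97022, 93182, 94202,
   94174, 128764, 128750, 21, 505786, 256990, 260026, 63422, 261084, 512990, 393050, 392762,
   786106, 519614, 786138, 786138, 785626, 519550, 786282, 519550, 785882, 785882, 1025886,
   1025886, 1027934, 1027934, 524010, 524010, 520060, 520030, 520060, 520046, 1040090, 1040090,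
   778108, 388862, 515834, 515806, 515834, 253678, 1040090, 1040090, 21, 505786, 256766, 260026,
   63422, 260860, 512766, 259806, 392762, 786106, 519614, 786138, 786138, 785626, 519550, 785898,
   519550, 520058, 520030, 1024990, 1024990, 1027038, 1027038, 524010, 524010, 519164, 519134,
   519164, 519150, 1040090, 1040090, 777212, 388862, 515834, 515806, 515834, 253678, 1040090,
   1040090, 63358, 88062, 97786, 97758, 97758, 97758, 46974, 96126, 16190, 16062, 14270, 28654,
   28654, 28542, 28542, 28638, 28638, 32508, 32494, 32508, 32494, 15, 126906, 128892, 65466,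
   16318, 127870, 63230, 114618, 229242, 130494, 229242, 32638, 229338, 130430, 258012, 130430,
   126970, 126942, 257532, 257502, 257532, 257518, 257914, 257886, 261850, 261850, 228348, 32510,
   130810, 130782, 130810, 65262, 261850, 261850, 16126, 27, 120766, 127422, 81886, 114652,
   128954, 127422, 112574, 225150, 225150, 229356, 229356, 254958, 254958, 254718, 252670, 254718,
   229356, 255710, 257786, 257758, 257786, 261850, 261850, 188286, 252158, 253662, 253690, 257758,
   257758, 196462, 196476, 196462, 196476, 27, 120766, 127422, 81662, 114428, 128954, 126398,
   112574, 225150, 225150, 225150, 225150, 225246, 225274, 254718, 252670, 254718, 229356, 255710,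
   257786, 257758, 257786, 261850, 261850, 187390, 252158, 253662, 253690, 257758, 257758, 195566,
   195580, 195566, 195580, 17, 130522, 63454, 112606, 124862, 96190, 97534, 128956, 257916,
   257902, 225262, 225262, 195070, 191998, 225246, 191998, 195578, 195550, 261978, 261978, 192254,
   192254, 196346, 196346, 253692, 253678, 259962, 259934, 253434, 253806, 259962, 188254, 253790,
   252798, 32318, 27, 120766, 127422, 49118, 11, 504828, 508670, 505086, 247742, 504574, 449502,
   515036, 450490, 900986, 900986, 900986, 900986, 1017342, 901082, 1009630, 1009660, 1009646,
   1009660, 1010654, 1010682, 1010670, 1010682, 1018846, 1027964, 1027038, 1027964, 1044316,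
   1044316, 487166, 1036252, 880510, 1011580, 1027038, 1027038, 986110, 786330, 990958, 990970,
   128954, 114526, 112574, 225150, 225150, 225150, 225150, 225276, 225276, 229230, 229244, 228830,
   228830, 255710, 257786, 257758, 257786, 261850, 261850, 122750, 188158, 253662, 253690, 257758,
   257758, 247550, 243454, 196462, 196476, 27, 120766, 127422, 48894, 126430, 128954, 114428,
   112574, 225150, 225150, 225150, 225150, 225246, 225276, 228846, 228860, 254846, 229340, 255710,
   257786, 257758, 257786, 261850, 261850, 121854, 188158, 253662, 253690, 257758, 257758, 247550,
   243454, 195566, 195580, 30462, 30462, 7, 25, 62910, 64574, 57308, 24542, 64954, 56798, 113598,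
   113534, 113630, 113630, 129262, 129262, 129246, 129786, 129758, 129786, 130778, 130778, 55294,
   64894, 128734, 128762, 127230, 114668, 129758, 129758, 98158, 98172, 98158, 98172, 13, 17,
   257466, 113406, 130490, 32190, 114428, 242942, 212922, 425850, 228286, 425850, 425822, 425946,
   228222, 485854, 485854, 486366, 486366, 261866, 261866, 228348, 228318, 228348, 228334, 521946,
   521946, 423932, 129790, 257018, 256990, 259834, 128750, 259834, 259806, 521946, 521946, 40830,
   52734, 63934, 52734, 64956, 129916, 129902, 64494, 105470, 96510, 80894, 113406, 105470,
   113406, 105470, 106490, 106462, 128764, 128750, 63358, 104446, 21, 505786, 256990, 260026,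
   63422, 261084, 512990, 458586, 458298, 917178, 519614, 917210, 917210, 916698, 519550, 917354,
   519550, 916954, 916954, 1025886, 1025886, 1027934, 1027934, 524010, 524010, 520060, 520030,
   520060, 520046, 1040090, 1040090, 909180, 257790, 515834, 253678, 515834, 515806, 1040090,
   1040090, 21, 505786, 256766, 260026, 63422, 260860, 512766, 259806, 458298, 917178, 519614,
   917210, 917210, 916698, 519550, 916970, 519550, 520058, 520030, 1024990, 1024990, 1027038,
   1027038, 524010, 524010, 519164, 519134, 519164, 519150, 1040090, 1040090, 908284, 257790,
   515834, 253678, 515834, 515806, 1040090, 1040090, 63482, 112622, 97786, 97758, 87934, 63358,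
   16190, 16062, 12222, 24558, 24558, 24446, 24446, 24542, 24542, 32508, 32494, 32508, 32494, 27,
   120766, 127422, 114652, 49118, 128954, 127422, 112574, 225150, 225150, 229356, 229356, 254958,
   254958, 254718, 252670, 254718, 229356, 255710, 257786, 257758, 257786, 261850, 261850, 122750,
   252158, 253662, 253690, 257758, 257758, 196462, 196476, 196462, 196476, 27, 120766, 127422,
   114428, 48894, 128954, 126398, 112574, 225150, 225150, 225150, 225150, 225246, 225274, 254718,
   252670, 254718, 229356, 255710, 257786, 257758, 257786, 261850, 261850, 121854, 252158, 253662,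
   253690, 257758, 257758, 195566, 195580, 195566, 195580, 15, 126906, 128892, 65466, 16318,
   127870, 63230, 98234, 196474, 130494, 196474, 32638, 196570, 130430, 258012, 130430, 126970,
   126942, 257532, 257502, 257532, 257518, 257914, 257886, 261850, 261850, 195580, 32510, 130810,
   65262, 130810, 130782, 261850, 261850, 16126, 27, 120766, 127422, 11, 504828, 508670, 505086,
   504574, 247742, 383966, 515036, 384954, 769914, 769914, 769914, 769914, 1017342, 770010,
   1009630, 1009660, 1009646, 1009660, 1010654, 1010682, 1010670, 1010682, 1018846, 1027964,
   1027038, 1027964, 1044316, 1044316, 487166, 466686, 749438, 1011580, 986110, 786330, 1027038,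
   1027038, 990958, 990970, 32734, 128954, 98142, 96190, 192382, 192382, 192382, 192382, 192508,
   192508, 196462, 196476, 196062, 196062, 255710, 257786, 257758, 257786, 261850, 261850, 122750,
   220926, 253662, 253690, 247550, 243454, 257758, 257758, 130926, 130940, 27, 120766, 127422,
   126430, 32510, 128954, 98044, 96190, 192382, 192382, 192382, 192382, 192478, 192508, 196078,
   196092, 254846, 196572, 255710, 257786, 257758, 257786, 261850, 261850, 121854, 220926, 253662,
   253690, 247550, 243454, 257758, 257758, 130030, 130044, 17, 130522, 63454, 120798, 124862,
   127994, 127230, 128956, 257916, 257902, 241646, 241646, 254462, 191998, 241630, 191998, 254970,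
   254942, 261978, 261978, 258010, 258010, 258010, 258010, 253692, 253678, 253434, 253806, 259962,
   259934, 259066, 221022, 253790, 252798, 32318, 28414, 28414, 6142, 6142, 7166, 7166, 8158,
   8186, 11, 17, 57214, 65402, 96126, 126398, 130170, 130682, 130492, 260988, 260974, 260334,
   192254, 113662, 241406, 261610, 261610, 261594, 261594, 260586, 260586, 261098, 261098, 258554,
   196078, 259836, 259822, 130554, 130526, 130554, 65006, 130554, 130526, 261594, 261594, 17,
   113658, 80894, 105982, 126398, 64990, 105982, 130492, 260988, 260974, 130030, 211966, 194814,
   162814, 229114, 210926, 228094, 211966, 212958, 212958, 229338, 130810, 128894, 210942, 259836,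
   259822, 225274, 225246, 129018, 227310, 192506, 192478, 187774, 128894, 32190, 31678, 17,
   130010, 97246, 97758, 126398, 62974, 121694, 130492, 260988, 260974, 195566, 195566, 112382,
   240638, 225146, 243566, 228094, 243070, 245598, 245598, 261978, 130810, 194542, 194542, 259836,
   259822, 257914, 257886, 258430, 194430, 257914, 257886, 253182, 128894, 24510, 49134, 49134,
   49022, 49022, 49118, 49118, 31742, 32762, 19, 258010, 192478, 194526, 251838, 128990, 243678,
   128766, 260028, 520060, 520046, 389102, 389102, 225278, 486910, 257918, 487294, 389102, 389102,
   458490, 483182, 454398, 487294, 491358, 491358, 524122, 261882, 515836, 515822, 507770, 507742,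
   509822, 384894, 507770, 507742, 520446, 253822, 19, 257786, 192254, 194302, 251838, 128766,
   243454, 243454, 260028, 520060, 520046, 517102, 388606, 258030, 486910, 257534, 486910, 389102,
   389102, 458490, 482286, 454398, 486398, 490462, 490462, 523226, 261882, 515836, 515822, 506874,
   506846, 508926, 383998, 506874, 506846, 520446, 252926, 65276, 65262, 65276, 65262, 21, 130302,
   129018, 227294, 243646, 194298, 259038, 128766, 260028, 520060, 520046, 454638, 454638, 257534,
   506366, 454622, 454622, 258042, 258014, 261086, 261086, 520030, 520030, 392170, 392170, 383994,
   520030, 383994, 450398, 515836, 515822, 515950, 515950, 253946, 253918, 516058, 516058, 32510,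
   21, 258010, 192478, 227294, 243646, 128990, 227294, 258302, 260028, 520060, 520046, 454638,
   454638, 386046, 388606, 516990, 388990, 454638, 454638, 522490, 450414, 518398, 454526, 458590,
   458590, 524122, 261882, 253822, 450430, 515836, 515822, 507770, 507742, 507770, 507742, 489214,
   253822, 21, 257786, 192254, 227070, 243646, 128766, 227070, 194302, 260028, 520060, 520046,
   258030, 454142, 517102, 388606, 516606, 388606, 389086, 389086, 522490, 449518, 518398, 453630,
   457694, 457694, 523226, 261882, 252926, 449534, 515836, 515822, 506874, 506846, 506874, 506846,
   489214, 252926, 21, 258554, 128990, 253406, 243646, 259962, 259066, 258302, 260028, 520060,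
   520046, 506862, 506862, 516606, 388606, 506846, 388606, 517114, 517086, 392954, 518106, 520154,
   520154, 523754, 523754, 515578, 261882, 515578, 522094, 515836, 515822, 509946, 509918, 383994,
   489310, 515934, 514942, 65086, 57086, 57086, 13, 27, 122302, 130110, 98142, 130908, 97246,
   130490, 128862, 257726, 257662, 257758, 257758, 260334, 260334, 260318, 260858, 260830, 260858,
   261850, 261850, 260830, 260830, 161790, 195966, 161790, 257406, 259806, 259834, 258302, 261612,
   261486, 261500, 261486, 261500, 17, 17, 507322, 256766, 261562, 252670, 64958, 257788, 517374,
   380858, 761722, 515006, 761722, 505342, 761818, 514942, 1034718, 1034718, 1035230, 1035230,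
   524010, 524010, 515068, 515038, 515068, 515054, 519162, 519134, 519162, 519150, 1046234,
   1046234, 767996, 391934, 521978, 486398, 521978, 259822, 1046234, 1046234, 81790, 96126,
   126398, 96126, 94718, 130492, 260988, 260974, 130030, 192254, 194814, 162814, 192494, 192494,
   195326, 189438, 194554, 190430, 192494, 192494, 196090, 196062, 259836, 259822, 128894, 187902,
   196090, 196062, 129018, 253422, 96126, 194430, 32190, 31678, 16318, 28606, 57326, 57326, 57214,
   57214, 32750, 32750, 15, 253882, 130940, 131002, 124926, 32702, 130940, 126718, 131004, 262012,
   261566, 262012, 65406, 262108, 261502, 262108, 261502, 253946, 253918, 261628, 261598, 261628,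
   261614, 253946, 253934, 520058, 520030, 523994, 523994, 457724, 65278, 261882, 261854, 261882,
   130798, 523994, 523994, 32510, 19, 258526, 129018, 194526, 251838, 194430, 259038, 128766,
   260028, 520060, 520046, 389102, 389102, 225278, 486910, 389086, 389086, 258042, 258014, 517982,
   517982, 520030, 520030, 520030, 520030, 520030, 520030, 515836, 515822, 384862, 384862, 253946,
   253918, 515950, 515950, 450302, 450302, 32510, 65276, 65262, 65276, 65262, 29, 227262, 258494,
   196062, 261596, 192478, 260026, 258494, 253374, 506750, 506750, 523244, 523244, 517102, 517102,
   516862, 490238, 516862, 523244, 517854, 519930, 519902, 519930, 523994, 523994, 519902, 519902,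
   384894, 391038, 384894, 514302, 515806, 515834, 522094, 522108, 522094, 522108, 29, 227262,
   258494, 195838, 261372, 192254, 260026, 245182, 253374, 506750, 506750, 506750, 506750, 506846,
   495610, 516862, 490238, 516862, 523244, 517854, 519930, 519902, 519930, 523994, 523994, 519902,
   519902, 383998, 390142, 383998, 514302, 515806, 515834, 521198, 521212, 521198, 521212, 21,
   257502, 128990, 227294, 243646, 250366, 194494, 258302, 260028, 520060, 520046, 454638, 454638,
   386046, 388606, 454622, 388606, 517114, 517086, 515934, 515934, 388862, 388862, 392926, 392926,
   522078, 522078, 509946, 509918, 515836, 515822, 515578, 515950, 384862, 384862, 515934, 514942,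
   65086, 21, 21, 982458, 503550, 523706, 487166, 258494, 507644, 1030908, 1023230, 999098,
   1998202, 1014718, 1998202, 974334, 1998298, 1014654, 2046430, 2046430, 2046942, 2046942,
   2046942, 2046942, 2063340, 2063340, 2060252, 2060252, 1014780, 1014750, 1014780, 1014766,
   1031162, 1031134, 1031162, 1031150, 2094810, 2094810, 2017276, 509694, 1046266, 900094,
   2094810, 2094810, 196062, 253406, 243646, 253406, 247774, 258302, 260028, 520060, 520046,
   506862, 506862, 516606, 388606, 516990, 388990, 506862, 506862, 507758, 507758, 518398, 495486,
   515962, 499550, 507758, 507758, 522106, 522078, 515836, 515822, 253822, 489342, 522106, 522078,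
   384766, 253822, 29, 227262, 258494, 130302, 245214, 126718, 260026, 261372, 253374, 506750,
   506750, 506750, 506750, 506846, 506876, 522734, 522748, 516990, 523228, 517854, 519930, 519902,
   519930, 523994, 523994, 519902, 519902, 252926, 259070, 252926, 384766, 515806, 515834, 509694,
   456446, 521198, 521212, 64446, 64446, 11, 17, 57214, 97246, 89598, 126398, 130010, 127454,
   130492, 260988, 260974, 260334, 179198, 123902, 241406, 114654, 114654, 211838, 254846, 259962,
   255838, 261994, 130810, 257914, 257886, 259836, 259822, 258554, 194542, 258430, 161790, 257914,
   257886, 257406, 96254, 17, 65374, 80894, 112510, 126398, 113658, 111102, 130492, 260988,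
   260974, 130030, 225022, 194814, 162814, 130910, 130910, 228094, 222206, 227322, 223198, 229354,
   130810, 225274, 225246, 259836, 259822, 128894, 220670, 129018, 253422, 192506, 192478, 161662,
   128894, 32190, 31678, 17, 130142, 65018, 114142, 126398, 62974, 130270, 130492, 260988, 260974,
   228334, 228334, 125950, 240638, 260446, 260446, 260958, 260958, 260958, 260958, 260958, 260958,
   129018, 128990, 259836, 259822, 186362, 227166, 259950, 259950, 129018, 128990, 260058, 260058,
   24510, 49146, 49134, 49022, 49022, 49118, 49118, 31742, 32762, 19, 258526, 129018, 227294,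
   251838, 227198, 259038, 128766, 260028, 520060, 520046, 454638, 454638, 257534, 486910, 454622,
   454622, 258042, 258014, 517982, 517982, 520030, 520030, 520030, 520030, 520030, 520030, 515836,
   515822, 383994, 450398, 515950, 515950, 253946, 253918, 516058, 516058, 32510, 65276, 65262,
   65276, 65262, 21, 130526, 192478, 194526, 243646, 258010, 247774, 128766, 260028, 520060,
   520046, 389102, 389102, 233470, 506366, 257918, 506750, 389102, 389102, 261982, 261982, 454398,
   495486, 515962, 499550, 524138, 261882, 507770, 507742, 515836, 515822, 509822, 384894, 507770,
   507742, 514302, 253822, 21, 130302, 192254, 194302, 243646, 257786, 247550, 253182, 260028,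
   520060, 520046, 517102, 388606, 258030, 506366, 257534, 506366, 389102, 389102, 261086, 261086,
   454398, 494590, 515066, 498654, 523242, 261882, 506874, 506846, 515836, 515822, 508926, 383998,
   506874, 506846, 514302, 252926, 21, 130526, 192478, 253406, 243646, 258010, 247774, 258302,
   260028, 520060, 520046, 506862, 506862, 386046, 388606, 516990, 388990, 506862, 506862, 261982,
   261982, 518398, 495486, 515962, 499550, 524138, 261882, 507770, 507742, 515836, 515822, 253822,
   489342, 507770, 507742, 384766, 253822, 21, 130302, 192254, 253182, 243646, 257786, 247550,
   194302, 260028, 520060, 520046, 258030, 506366, 517102, 388606, 516606, 388606, 389086, 389086,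
   261086, 261086, 518398, 494590, 515066, 498654, 523242, 261882, 506874, 506846, 515836, 515822,
   252926, 488446, 506874, 506846, 384766, 252926, 21, 130526, 128990, 227294, 243646, 258554,
   259066, 258302, 260028, 520060, 520046, 454638, 454638, 516606, 388606, 454622, 388606, 517114,
   517086, 261982, 261982, 520154, 520154, 520154, 520154, 522078, 261882, 509946, 509918, 515836,
   515822, 515578, 515950, 488442, 384862, 515934, 514942, 65086, 64446, 64446, 11, 27, 122302,
   130110, 130908, 65374, 64478, 130490, 128862, 257726, 257662, 257758, 257758, 260334, 260334,
   260318, 260858, 260830, 260858, 261850, 261850, 260830, 260830, 96254, 130430, 96254, 257406,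
   259806, 259834, 258302, 261612, 261486, 261500, 261486, 261500, 17, 17, 507322, 256766, 261562,
   64958, 252670, 257788, 517374, 446394, 892794, 515006, 892794, 505342, 892890, 514942, 1034718,
   1034718, 1035230, 1035230, 524010, 524010, 515068, 515038, 515068, 515054, 519162, 519134,
   519162, 519150, 1046234, 1046234, 899068, 260862, 521978, 259822, 521978, 486398, 1046234,
   1046234, 81790, 112510, 126398, 112510, 111102, 130492, 260988, 260974, 130030, 225022, 194814,
   162814, 225262, 225262, 228094, 222206, 227322, 223198, 225262, 225262, 228858, 228830, 259836,
   259822, 128894, 220670, 129018, 253422, 196090, 196062, 161662, 128894, 32190, 31678, 16318,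
   24510, 49134, 49134, 49022, 49022, 32750, 32750, 15, 253882, 130940, 131002, 32702, 124926,
   130940, 126718, 131004, 262012, 261566, 262012, 65406, 262108, 261502, 262108, 261502, 253946,
   253918, 261628, 261598, 261628, 261614, 253946, 253934, 520058, 520030, 523994, 523994, 392188,
   65278, 261882, 130798, 261882, 261854, 523994, 523994, 32510, 19, 258526, 129018, 227294,
   251838, 227198, 259038, 128766, 260028, 520060, 520046, 454638, 454638, 257534, 486910, 454622,
   454622, 258042, 258014, 517982, 517982, 520030, 520030, 520030, 520030, 520030, 520030, 515836,
   515822, 383994, 450398, 515950, 515950, 253946, 253918, 516058, 516058, 32510, 65276, 65262,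
   65276, 65262, 29, 227262, 258494, 261596, 130526, 126942, 260026, 258494, 253374, 506750,
   506750, 523244, 523244, 517102, 517102, 516862, 490238, 516862, 523244, 517854, 519930, 519902,
   519930, 523994, 523994, 519902, 519902, 253822, 259966, 253822, 514302, 515806, 515834, 522094,
   522108, 522094, 522108, 29, 227262, 258494, 261372, 130302, 126718, 260026, 245182, 253374,
   506750, 506750, 506750, 506750, 506846, 495610, 516862, 490238, 516862, 523244, 517854, 519930,
   519902, 519930, 523994, 523994, 519902, 519902, 252926, 259070, 252926, 514302, 515806, 515834,
   521198, 521212, 521198, 521212, 21, 21, 982458, 503550, 523706, 258494, 487166, 507644,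
   1030908, 1023230, 999098, 1998202, 1014718, 1998202, 974334, 1998298, 1014654, 2046430,
   2046430, 2046942, 2046942, 2046942, 2046942, 2063340, 2063340, 2060252, 2060252, 1014780,
   1014750, 1014780, 1014766, 1031162, 1031134, 1031162, 1031150, 2094810, 2094810, 2017276,
   509694, 1046266, 900094, 2094810, 2094810, 196062, 253406, 243646, 253406, 247774, 258302,
   260028, 520060, 520046, 506862, 506862, 386046, 388606, 516990, 388990, 506862, 506862, 507758,
   507758, 518398, 495486, 515962, 499550, 507758, 507758, 522106, 522078, 515836, 515822, 253822,
   489342, 522106, 522078, 384766, 253822, 29, 227262, 258494, 245214, 130302, 126718, 260026,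
   261372, 253374, 506750, 506750, 506750, 506750, 506846, 506876, 522734, 522748, 516990, 523228,
   517854, 519930, 519902, 519930, 523994, 523994, 519902, 519902, 252926, 259070, 252926, 384766,
   515806, 515834, 509694, 456446, 521198, 521212, 21, 257502, 128990, 227294, 243646, 250366,
   259066, 258302, 260028, 520060, 520046, 454638, 454638, 516606, 388606, 454622, 388606, 517114,
   517086, 515934, 515934, 520154, 520154, 520154, 520154, 522078, 522078, 509946, 509918, 515836,
   515822, 515578, 515950, 488442, 384862, 515934, 514942, 65086, 64446, 64446, 4094, 23, 30654,
   32654, 32506, 31740, 31614, 32698, 65310, 65402, 65374, 65402, 65498, 65498, 63470, 63484,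
   65514, 65514, 48894, 64506, 57086, 57086, 65246, 65274, 65374, 65374, 65086, 65438, 61422,
   61436, 4094, 23, 30654, 32654, 32252, 32506, 32126, 32698, 65310, 65402, 65374, 65402, 65498,
   65498, 64494, 64508, 65514, 65514, 48894, 48894, 57086, 64506, 65246, 65274, 65086, 65438,
   65374, 65374, 63470, 63484, 8158, 8186]

theorem check_certificateFive :
    ((Pattern.hex [true, false, false, true, true, false]).check 6 5
      certificateFive).isSome = true := by
  decide +kernel

/-- Nine internally disjoint paths joining three vertices to three others form a subdivision of
`K_{3,3}`. -/
theorem Pattern.hex_occurs {G : SimpleGraph V} (κ : V → Bool) {a b : Fin 3 → V}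
    (ha : Function.Injective a) (hb : Function.Injective b) (hab : ∀ i j, a i ≠ b j)
    {T : Fin 3 → Fin 3 → Set V} (hT : ∀ i j, G.IsPathSet (a i) (b j) (T i j))
    (hmeet : ∀ i j i' j', (i, j) ≠ (i', j') → ∀ x ∈ T i j, x ∈ T i' j' →
      x = a i ∧ i = i' ∨ x = b j ∧ j = j') :
    (Pattern.hex [κ (a 0), κ (a 1), κ (a 2), κ (b 0), κ (b 1), κ (b 2)]).Occurs G κ := by
  let f : ℕ → V := fun n => if n < 3 then a (Fin.ofNat 3 n) else b (Fin.ofNat 3 n)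
  have hmem : ∀ e ∈ (Pattern.hex [κ (a 0), κ (a 1), κ (a 2), κ (b 0), κ (b 1), κ (b 2)]).edges,
      ∃ i j : Fin 3, e = (i.val, j.val + 3) := by
    simp [Pattern.hex, Fin.exists_fin_succ]
  have hfa : ∀ i : Fin 3, f i.val = a i := fun i => by fin_cases i <;> rfl
  have hfb : ∀ j : Fin 3, f (j.val + 3) = b j := fun j => by fin_cases j <;> rfl
  have hS : ∀ i j : Fin 3, T (Fin.ofNat 3 i.val) (Fin.ofNat 3 (j.val + 3)) = T i j :=
    fun i j => by fin_cases i <;> fin_cases j <;> rfl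
  refine ⟨f, fun e => T (Fin.ofNat 3 e.1) (Fin.ofNat 3 e.2), ?_, ?_, ?_, ?_, ?_, ?_⟩
  · intro e he t ht
    obtain ⟨i, j, rfl⟩ := hmem e he
    simp only [Pattern.hex]
    rcases ht with rfl | rfl <;> dsimp only <;> omega
  · intro e he
    obtain ⟨i, j, rfl⟩ := hmem e he
    dsimp only
    omega
  · intro e he e' he' t t' ht ht' htt
    obtain ⟨i, j, rfl⟩ := hmem e he
    obtain ⟨i', j', rfl⟩ := hmem e' he'
    rcases ht with rfl | rfl <;> rcases ht' with rfl | rfl <;>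
      simp only [hfa, hfb] at htt ⊢
    · rw [ha htt]
    · exact absurd htt (hab _ _)
    · exact absurd htt.symm (hab _ _)
    · rw [hb htt]
  · intro e he t ht
    obtain ⟨i, j, rfl⟩ := hmem e he
    rcases ht with rfl | rfl <;> simp only [hfa, hfb]
    · fin_cases i <;> rfl
    · fin_cases j <;> rfl
  · intro e he
    obtain ⟨i, j, rfl⟩ := hmem e he
    simpa only [hfa, hfb, hS] using hT i j
  · intro e he e' he' hne x hx hx'
    obtain ⟨i, j, rfl⟩ := hmem e he
    obtain ⟨i', j', rfl⟩ := hmem e' he'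
    simp only [hS] at hx hx'
    rcases hmeet i j i' j' (by rintro ⟨⟩; exact hne rfl) x hx hx' with ⟨rfl, rfl⟩ | ⟨rfl, rfl⟩
    · exact ⟨i, (hfa i).symm, Or.inl rfl, Or.inl rfl⟩
    · exact ⟨j.val + 3, (hfb j).symm, Or.inr rfl, Or.inr rfl⟩

namespace Hex

variable {G : SimpleGraph V} {κ : V → Bool}

theorem isPathSet (H : G.Hex) (i j : Fin 3) :
    G.IsPathSet (H.fA i) (H.fB j) {x | x ∈ (H.seg i j).support} :=
  ⟨H.seg i j, H.seg_path i j, fun _ => Iff.rfl⟩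

theorem occurs (H : G.Hex) (κ : V → Bool) (σ τ : Equiv.Perm (Fin 3)) :
    (Pattern.hex [κ (H.fA (σ 0)), κ (H.fA (σ 1)), κ (H.fA (σ 2)),
      κ (H.fB (τ 0)), κ (H.fB (τ 1)), κ (H.fB (τ 2))]).Occurs G κ := by
  refine Pattern.hex_occurs κ (H.injA.comp σ.injective) (H.injB.comp τ.injective)
    (fun i j => H.disjAB _ _) (fun i j => H.isPathSet (σ i) (τ j)) fun i j i' j' hne x hx hx' => ?_
  have := H.seg_meet (σ i) (τ j) (σ i') (τ j') (by simpa using hne) x hx hx'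
  simpa using this

theorem occurs_swap (H : G.Hex) (κ : V → Bool) (σ τ : Equiv.Perm (Fin 3)) :
    (Pattern.hex [κ (H.fB (τ 0)), κ (H.fB (τ 1)), κ (H.fB (τ 2)),
      κ (H.fA (σ 0)), κ (H.fA (σ 1)), κ (H.fA (σ 2))]).Occurs G κ := by
  refine Pattern.hex_occurs κ (H.injB.comp τ.injective) (H.injA.comp σ.injective)
    (fun j i => (H.disjAB _ _).symm) (fun j i => (H.isPathSet (σ i) (τ j)).symm)
    fun j i j' i' hne x hx hx' => ?_
  have := H.seg_meet (σ i) (τ j) (σ i') (τ j') (by simpa [and_comm] using hne) x hx hx'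
  simpa using this.symm

theorem oddCount_eq_s10 (hκ : ∀ x y, G.Adj x y → κ x ≠ κ y) (H : G.Hex) :
    H.oddCount = ∑ i, ∑ j, bif κ (H.fA i) ^^ κ (H.fB j) then 1 else 0 := by
  rw [oddCount, Finset.card_filter, ← Finset.univ_product_univ, Finset.sum_product]
  refine Finset.sum_congr rfl fun i _ => Finset.sum_congr rfl fun j _ => ?_
  rw [if_congr (Pattern.odd_length_iff hκ (H.seg i j)) rfl rfl]
  cases κ (H.fA i) <;> cases κ (H.fB j) <;> rfl

/-- Up to symmetry there are four colourings of the feet with fewer than six odd segments. -/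
theorem exists_colors_eq : ∀ u v : Fin 3 → Bool, ∃ (c : Bool) (σ τ : Equiv.Perm (Fin 3)),
    let n := ∑ i, ∑ j, bif (u i ^^ c) ^^ (v j ^^ c) then 1 else 0
    let l := [u (σ 0) ^^ c, u (σ 1) ^^ c, u (σ 2) ^^ c]
    let r := [v (τ 0) ^^ c, v (τ 1) ^^ c, v (τ 2) ^^ c]
    6 ≤ n ∨ (n = 0 ∧ l ++ r = [false, false, false, false, false, false]) ∨
      (n = 3 ∧ l ++ r = [false, false, false, true, false, false]) ∨
      (n = 3 ∧ r ++ l = [false, false, false, true, false, false]) ∨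
      (n = 4 ∧ l ++ r = [true, false, false, true, false, false]) ∨
      (n = 5 ∧ l ++ r = [true, false, false, true, true, false]) := by
  decide +kernel

theorem exists_lt_oddCount [Finite V] (hκ : ∀ x y, G.Adj x y → κ x ≠ κ y)
    (hconn : ∀ a b : V, (G.induce ({a, b} : Set V)ᶜ).Connected) (H : G.Hex)
    (hH : H.oddCount < 6) : ∃ H' : G.Hex, H.oddCount < H'.oddCount := by
  obtain ⟨c, σ, τ, hc⟩ := exists_colors_eq (fun i => κ (H.fA i)) (fun j => κ (H.fB j))
  have hκc : ∀ x y, G.Adj x y → (κ x ^^ c) ≠ (κ y ^^ c) := fun x y hxy => by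
    simpa using hκ x y hxy
  have hl := H.occurs (fun x => κ x ^^ c) σ τ
  have hr := H.occurs_swap (fun x => κ x ^^ c) σ τ
  have improve : ∀ {P : Pattern} {thr d : ℕ} {ts : List ℕ}, (P.check thr d ts).isSome = true →
      P.Occurs G (fun x => κ x ^^ c) → ∃ H' : G.Hex, thr ≤ H'.oddCount := fun hP ho => by
    obtain ⟨_, hP⟩ := Option.isSome_iff_exists.1 hP
    exact ho.exists_hex_of_check hκc hconn hP
  dsimp only at hc
  rw [← H.oddCount_eq_s10 hκc] at hc
  rcases hc with hn | ⟨hn, he⟩ | ⟨hn, he⟩ | ⟨hn, he⟩ | ⟨hn, he⟩ | ⟨hn, he⟩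
  · omega
  all_goals simp only [List.cons_append, List.nil_append] at he
  all_goals rw [hn]
  · exact improve check_certificateZero (he ▸ hl)
  · exact improve check_certificateThree (he ▸ hl)
  · exact improve check_certificateThree (he ▸ hr)
  · exact improve check_certificateFour (he ▸ hl)
  · exact improve check_certificateFive (he ▸ hl)

end Hex

end SimpleGraph

/-- In an internally 4-connected bipartite graph, every optimal hex has at least six odd
segments. -/
theorem stmt_10 {V : Type u} [Fintype V] (G : SimpleGraph V) (A B : Set V)
    (hbip : G.IsBipartition A B) (h4 : G.InternallyFourConnected)
    (H : G.Hex) (hopt : H.Optimal) :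
    6 ≤ H.oddCount := by
  classical
  by_contra! hH
  have hκ : ∀ x y, G.Adj x y → decide (x ∈ A) ≠ decide (y ∈ A) := by
    intro x y hxy
    have hd : ∀ {z}, z ∈ A → z ∈ B → False := fun ha hb => hbip.1.ne_of_mem ha hb rfl
    rcases hbip.2.2 hxy with ⟨hx, hy⟩ | ⟨hx, hy⟩
    · simpa [hx] using fun h => hd h hy
    · simpa [hy] using fun h => hd h hx
  have hconn : ∀ a b : V, (G.induce ({a, b} : Set V)ᶜ).Connected := fun a b =>
    h4.1.2 _ ((Set.ncard_insert_le a {b}).trans (by simp))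
  obtain ⟨H', hH'⟩ := H.exists_lt_oddCount hκ hconn hH
  exact (hopt H').not_gt hH'
end
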